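/- arXiv:2312.15246 — 12 statements merged into one kernel-verified Lean document; each statement's English description precedes it below -/
import Mathlib

section
/- Let F be an R-flow on S with R(S*) > 0, with forward policy π_f, and let (s_t)_{t≥0} be the associated Markov chain started at s0 with sampling time τ := sup{t ∈ ℕ : s_t ≠ sf}. Then τ is almost surely finite. -/
open MeasureTheory ProbabilityTheory Filter
open scoped ENNReal

/-- If `ν` dominates `c δ_a + ν κ` away from `b`, where `b` is never left by `κ`, then `ν` dominates
`c` times the expected occupation measure, away from `b`, of the chain of kernel `κ` started at
`a`. -/
lemma smul_sum_restrict_compl_le {S : Type*} [MeasurableSpace S] [MeasurableSingletonClass S]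
    {κ : Kernel S S} {ν : Measure S} {L : ℕ → Measure S} {a b : S} {c : ℝ≥0∞}
    (hb : κ b {b}ᶜ = 0) (h0 : L 0 = Measure.dirac a)
    (hL : ∀ n B, MeasurableSet B → L (n + 1) B = ∫⁻ x, κ x B ∂(L n))
    (hν : ∀ A, MeasurableSet A →
      c * Measure.dirac a (A ∩ {b}ᶜ) + ∫⁻ x, κ x (A ∩ {b}ᶜ) ∂ν ≤ ν A) (N : ℕ) :
    c • ∑ n ∈ Finset.range N, (L n).restrict {b}ᶜ ≤ ν := by
  induction N with
  | zero => simpa using Measure.zero_le ν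
  | succ N ih =>
    refine Measure.le_intro fun A hA _ => le_trans (le_of_eq ?_)
      ((add_le_add_right (lintegral_mono' ih le_rfl) _).trans (hν A hA))
    have hstep : ∀ n, ((L (n + 1)).restrict {b}ᶜ) A
        = ∫⁻ x, κ x (A ∩ {b}ᶜ) ∂((L n).restrict {b}ᶜ) := fun n => by
      have hB : MeasurableSet (A ∩ {b}ᶜ) := hA.inter (measurableSet_singleton b).compl
      rw [Measure.restrict_apply hA, hL n _ hB, setLIntegral_eq_of_support_subset]
      intro x hx hxb
      obtain rfl : x = b := hxb
      exact hx (measure_mono_null Set.inter_subset_right hb)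
    rw [Finset.sum_range_succ', lintegral_smul_measure, lintegral_finsetSum_measure,
      Measure.smul_apply, Measure.add_apply, Measure.finsetSum_apply, h0,
      Measure.restrict_apply hA, smul_eq_mul, smul_eq_mul, mul_add, add_comm]
    simp_rw [hstep]

/-- The supremum of a set of natural numbers is finite if all large numbers lie outside it. -/
lemma iSup_natCast_lt_top_of_eventually_not {p : ℕ → Prop} (h : ∀ᶠ n in atTop, ¬ p n) :
    (⨆ (t : ℕ) (_ : p t), (t : ℕ∞)) < ⊤ := by
  obtain ⟨N, hN⟩ := eventually_atTop.1 h
  refine lt_of_le_of_lt (iSup₂_le fun t ht => ?_) (ENat.natCast_lt_top N)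
  exact_mod_cast (not_le.1 fun hle => hN t hle ht).le

/-- Let `F` be an `R`-flow on a measurable space `S` (with source `s0` and
sink `sf`, `S* = {s0, sf}ᶜ`) with `R(S*) > 0`, let `π` be a forward policy of `F`, and let
`μ` be the law of the Markov chain `(s_t)` started at `s0` with transition kernel `π`.
Then the sampling time `τ = sup {t | s_t ≠ sf}` is almost surely finite. -/
theorem sampling_time_ae_finite
    {S : Type*} [MeasurableSpace S] [MeasurableSingletonClass S]
    (s0 sf : S) (hne : s0 ≠ sf)
    -- `F` is an edgeflow
    (F : Measure (S × S)) [IsFiniteMeasure F]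
    (hFsrc : F (Set.univ ×ˢ {s0}) = 0)
    (hFsnk : F ({sf} ×ˢ ({sf}ᶜ : Set S)) = 0)
    -- the reward measure `R`
    (R : Measure S) [IsFiniteMeasure R]
    (hRs0 : R {s0} = 0) (hRsf : R {sf} = 0)
    -- `F` satisfies the reward constraint
    (hreward : ∀ A : Set S, MeasurableSet A → F (A ×ˢ {sf}) = R A)
    -- `F` satisfies the flow-matching constraint on `S* = {s0, sf}ᶜ`
    (hmatch : ∀ A : Set S, MeasurableSet A → A ⊆ ({s0, sf} : Set S)ᶜ →
      F.map Prod.snd A = F.map Prod.fst A)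
    -- `R(S*) > 0`
    (hRpos : 0 < R (({s0, sf} : Set S)ᶜ))
    -- `π` is a forward policy of `F`
    (π : Kernel S S) [IsMarkovKernel π]
    (hπsink : π sf = Measure.dirac sf)
    (hπF : ∀ A B : Set S, MeasurableSet A → MeasurableSet B →
      F (A ×ˢ B) = ∫⁻ x in A, π x B ∂(F.map Prod.fst))
    -- `μ` is the law of the Markov chain of kernel `π` started at `s0`
    (μ : Measure (ℕ → S)) [IsProbabilityMeasure μ]
    (hinit : μ {ω | ω 0 = s0} = 1)
    (hmarkov : ∀ (n : ℕ) (A : Set (ℕ → S)) (B : Set S),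
      MeasurableSet[MeasurableSpace.comap
        (fun (ω : ℕ → S) (i : Fin (n + 1)) => ω i.val) inferInstance] A →
      MeasurableSet B →
      μ (A ∩ {ω | ω (n + 1) ∈ B}) = ∫⁻ ω in A, π (ω n) B ∂μ) :
    -- the sampling time `τ = sup {t | s_t ≠ sf}` is almost surely finite
    μ {ω | (⨆ (t : ℕ) (_ : ω t ≠ sf), (t : ℕ∞)) < ⊤} = 1 := by
  have hsf : MeasurableSet ({sf} : Set S) := measurableSet_singleton sf
  have hs0 : MeasurableSet ({s0} : Set S) := measurableSet_singleton s0
  have hin : ∀ B, MeasurableSet B → F.map Prod.snd B = F (Set.univ ×ˢ B) := fun B hB => by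
    rw [Measure.map_apply measurable_snd hB, Set.univ_prod]
  have hout : ∀ B, MeasurableSet B → F.map Prod.fst B = F (B ×ˢ Set.univ) := fun B hB => by
    rw [Measure.map_apply measurable_fst hB, Set.prod_univ]
  have hin_s0 : F.map Prod.snd {s0} = 0 := by rw [hin _ hs0, hFsrc]
  have hout_sf : F.map Prod.fst {sf} = 0 := by
    rw [hout _ hsf, ← Set.union_compl_self {sf}, Set.prod_union]
    exact measure_union_null (by rw [hreward _ hsf, hRsf]) hFsnk
  have hin_sf : F.map Prod.snd {sf} = R Set.univ := by rw [hin _ hsf, hreward _ .univ]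
  have hmid : MeasurableSet ({s0, sf} : Set S)ᶜ :=
    (Set.toFinite ({s0, sf} : Set S)).measurableSet.compl
  have hout_s0 : F.map Prod.fst {s0} ≠ 0 := by
    intro hzero
    have h1 : F.map Prod.fst ({s0, sf} : Set S) = 0 := by
      rw [Set.insert_eq]; exact measure_union_null hzero hout_sf
    have h2 : F.map Prod.snd ({s0, sf} : Set S) = 0 := by
      have e1 := measure_add_measure_compl (μ := F.map Prod.fst) hmid
      have e2 := measure_add_measure_compl (μ := F.map Prod.snd) hmid
      rw [compl_compl, Measure.map_apply measurable_fst .univ] at e1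
      rw [compl_compl, Measure.map_apply measurable_snd .univ,
        hmatch _ hmid subset_rfl] at e2
      rw [Set.preimage_univ] at e1 e2
      rw [h1, add_zero] at e1
      rw [← e1] at e2
      exact (ENNReal.add_right_inj (measure_ne_top _ _)).1 (e2.trans (add_zero _).symm)
    have h3 : R Set.univ = 0 := by
      rw [← hin_sf]; exact measure_mono_null (by simp) h2
    exact hRpos.ne' (measure_mono_null (Set.subset_univ _) h3)
  have hdom : ∀ A, MeasurableSet A → F.map Prod.fst {s0} * Measure.dirac s0 (A ∩ {sf}ᶜ)
      + ∫⁻ x, π x (A ∩ {sf}ᶜ) ∂(F.map Prod.fst) ≤ F.map Prod.fst A := by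
    intro A hA
    have hB : MeasurableSet (A ∩ {sf}ᶜ) := hA.inter hsf.compl
    have hA' : MeasurableSet (A ∩ {s0, sf}ᶜ) := hA.inter hmid
    have hflow : ∫⁻ x, π x (A ∩ {sf}ᶜ) ∂(F.map Prod.fst)
        ≤ F.map Prod.fst (A ∩ {s0, sf}ᶜ) := by
      rw [← setLIntegral_univ, ← hπF _ _ .univ hB, ← hin _ hB,
        ← hmatch _ hA' Set.inter_subset_right]
      calc F.map Prod.snd (A ∩ {sf}ᶜ)
          ≤ F.map Prod.snd ((A ∩ {s0, sf}ᶜ) ∪ {s0}) := by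
            refine measure_mono fun x hx => ?_
            by_cases h : x = s0
            · exact Or.inr h
            · exact Or.inl ⟨hx.1, not_or.2 ⟨h, hx.2⟩⟩
        _ ≤ _ := (measure_union_le _ _).trans (by rw [hin_s0, add_zero])
    by_cases hmem : s0 ∈ A
    · calc _ ≤ F.map Prod.fst {s0} + F.map Prod.fst (A ∩ {s0, sf}ᶜ) :=
            add_le_add (mul_le_of_le_one_right' prob_le_one) hflow
        _ = F.map Prod.fst ({s0} ∪ (A ∩ {s0, sf}ᶜ)) :=
            (measure_union (by simp) hA').symm
        _ ≤ _ := measure_mono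
            (Set.union_subset (by simpa using hmem) Set.inter_subset_left)
    · have hdirac : Measure.dirac s0 (A ∩ {sf}ᶜ) = 0 := by
        rw [Measure.dirac_apply' _ hB]; simp [hmem]
      rw [hdirac, mul_zero, zero_add]
      exact hflow.trans (measure_mono Set.inter_subset_left)
  have hlaw0 : μ.map (fun ω => ω 0) = Measure.dirac s0 := by
    have hstart : MeasurableSet {ω : ℕ → S | ω 0 = s0} := hs0.preimage (measurable_pi_apply 0)
    have hae : (fun ω : ℕ → S => ω 0) =ᵐ[μ] fun _ => s0 :=

      (prob_compl_eq_zero_iff hstart).2 hinit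
    rw [Measure.map_congr hae, Measure.map_const, measure_univ, one_smul]
  have hlaw : ∀ n B, MeasurableSet B → μ.map (fun ω => ω (n + 1)) B
      = ∫⁻ x, π x B ∂(μ.map (fun ω => ω n)) := by
    intro n B hB
    have h := hmarkov n Set.univ B (@MeasurableSet.univ _ _) hB
    rw [Set.univ_inter, setLIntegral_univ] at h
    rw [Measure.map_apply (measurable_pi_apply _) hB,
      lintegral_map (π.measurable_coe hB) (measurable_pi_apply _)]
    exact h
  have hsum : F.map Prod.fst {s0} * ∑' n, μ {ω | ω n ≠ sf} ≤ F.map Prod.fst Set.univ := by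
    rw [ENNReal.tsum_eq_iSup_nat, ENNReal.mul_iSup]
    refine iSup_le fun N => ?_
    have h := smul_sum_restrict_compl_le (L := fun n => μ.map (fun ω => ω n)) (by simp [hπsink, hsf])
      hlaw0 hlaw hdom N Set.univ
    simp only [Measure.smul_apply, Measure.finsetSum_apply, Measure.restrict_apply_univ,
      smul_eq_mul] at h
    simp_rw [fun n => Measure.map_apply (μ := μ) (f := fun ω => ω n)
      (measurable_pi_apply n) hsf.compl] at h
    exact h
  have hfin : ∑' n, μ {ω | ω n ≠ sf} ≠ ∞ := fun htop => by
    rw [htop, ENNReal.mul_top hout_s0] at hsum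
    exact measure_ne_top _ _ (top_le_iff.1 hsum)
  have hae := ae_eventually_notMem hfin
  have hτ : ∀ᵐ ω ∂μ, (⨆ (t : ℕ) (_ : ω t ≠ sf), (t : ℕ∞)) < ⊤ :=
    hae.mono fun _ hω => iSup_natCast_lt_top_of_eventually_not hω
  exact (measure_congr (eventuallyEq_univ.2 hτ)).trans measure_univ
end

section
/- Let F be an R-flow on S with R(S*) > 0, with forward policy π_f and Markov chain (s_t) with sampling time τ (almost surely finite). Then the sampled state is distributed proportionally to the reward: for every measurable A ⊆ S*, P(s_τ ∈ A) = R(A)/R(S*). -/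
open MeasureTheory ProbabilityTheory Filter
open scoped ENNReal

/-- Finite-horizon expected visits of a Markov chain started at `s0`, counted off an absorbing
point `sf`, are dominated by any measure that is superinvariant off `sf`. -/
lemma smul_sum_restrict_le {S : Type*} [MeasurableSpace S] [MeasurableSingletonClass S]
    {s0 sf : S} {π : Kernel S S} {G : Measure S} {ν : ℕ → Measure S} {c : ℝ≥0∞}
    (hsf : π sf {sf}ᶜ = 0) (hν0 : ν 0 = Measure.dirac s0)
    (hν : ∀ n B, MeasurableSet B → ν (n + 1) B = ∫⁻ x, π x B ∂ν n)
    (hG : ∀ B, MeasurableSet B → sf ∉ B →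
      c * Measure.dirac s0 B + ∫⁻ x, π x B ∂G ≤ G B) (n : ℕ) :
    c • (∑ t ∈ Finset.range n, ν t).restrict {sf}ᶜ ≤ G := by
  have hmsf : MeasurableSet ({sf}ᶜ : Set S) := (measurableSet_singleton sf).compl
  induction n with
  | zero => simp [Measure.zero_le]
  | succ n ih =>
    refine Measure.le_iff.2 fun B hB => ?_
    have hB' : MeasurableSet (B ∩ {sf}ᶜ) := hB.inter hmsf
    have hπ : π sf (B ∩ {sf}ᶜ) = 0 := measure_mono_null Set.inter_subset_right hsf
    have hoff : ∫⁻ x, π x (B ∩ {sf}ᶜ) ∂(∑ t ∈ Finset.range n, ν t) =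
        ∫⁻ x in {sf}ᶜ, π x (B ∩ {sf}ᶜ) ∂(∑ t ∈ Finset.range n, ν t) := by
      rw [← lintegral_indicator hmsf]
      refine lintegral_congr fun x => ?_
      by_cases hx : x = sf
      · simp [hx, hπ]
      · simp [hx]
    calc (c • (∑ t ∈ Finset.range (n + 1), ν t).restrict {sf}ᶜ) B
        = c * ∑ t ∈ Finset.range (n + 1), ν t (B ∩ {sf}ᶜ) := by
          rw [Measure.smul_apply, Measure.restrict_apply hB, Measure.finsetSum_apply,
            smul_eq_mul]
      _ = c * Measure.dirac s0 (B ∩ {sf}ᶜ) + ∫⁻ x, π x (B ∩ {sf}ᶜ)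
            ∂(c • (∑ t ∈ Finset.range n, ν t).restrict {sf}ᶜ) := by
          rw [Finset.sum_range_succ', hν0, lintegral_smul_measure, ← hoff,
            lintegral_finsetSum_measure, add_comm, mul_add, smul_eq_mul]
          simp_rw [hν _ _ hB']
      _ ≤ c * Measure.dirac s0 (B ∩ {sf}ᶜ) + ∫⁻ x, π x (B ∩ {sf}ᶜ) ∂G := by
          gcongr
      _ ≤ G (B ∩ {sf}ᶜ) := hG _ hB' (by simp)
      _ ≤ G B := measure_mono Set.inter_subset_left

/-- The mass leaving the source of an `R`-flow is the total reward. -/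
lemma edgeflow_source_mass {S : Type*} [MeasurableSpace S] [MeasurableSingletonClass S]
    {s0 sf : S} (hne : s0 ≠ sf) {F : Measure (S × S)} [IsFiniteMeasure F]
    (hFsrc : F.map Prod.snd {s0} = 0) (hFsnk : F.map Prod.fst {sf} = 0)
    (hmatch : F.map Prod.snd ({s0, sf} : Set S)ᶜ = F.map Prod.fst ({s0, sf} : Set S)ᶜ) :
    F.map Prod.fst {s0} = F.map Prod.snd {sf} := by
  have hpair : MeasurableSet ({s0, sf} : Set S) := by measurability
  have key (m : Measure S) : m Set.univ = m {s0} + m {sf} + m ({s0, sf} : Set S)ᶜ := by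
    rw [← measure_add_measure_compl hpair, Set.insert_eq,
      measure_union (by simpa using hne) (measurableSet_singleton sf)]
  have h : F.map Prod.fst Set.univ = F.map Prod.snd Set.univ := by
    rw [Measure.map_apply measurable_fst .univ, Measure.map_apply measurable_snd .univ]; simp
  rw [key, key, hFsrc, hFsnk, hmatch, add_zero, zero_add] at h
  exact (ENNReal.add_left_inj (measure_ne_top _ _)).1 h

lemma exists_last_ne {S : Type*} {sf : S} {ω : ℕ → S} (h0 : ω 0 ≠ sf)
    (h : (⨆ (t : ℕ) (_ : ω t ≠ sf), (t : ℕ∞)) < ⊤) :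
    ∃ t, ω t ≠ sf ∧ ∀ t', t < t' → ω t' = sf := by
  classical
  obtain ⟨N, hN⟩ := ENat.ne_top_iff_exists.1 h.ne
  have hle : ∀ t, ω t ≠ sf → t ≤ N := fun t ht => by
    have : (t : ℕ∞) ≤ N := hN ▸ le_iSup₂_of_le t ht le_rfl
    exact_mod_cast this
  refine ⟨Nat.findGreatest (fun t => ω t ≠ sf) N,
    Nat.findGreatest_spec (P := fun t => ω t ≠ sf) (Nat.zero_le N) h0, fun t' ht' => ?_⟩
  by_contra hne
  exact (Nat.le_findGreatest (hle t' hne) hne).not_gt ht'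

lemma measurableSet_iSup_ne_lt_top {S : Type*} [MeasurableSpace S] [MeasurableSingletonClass S]
    (sf : S) : MeasurableSet {ω : ℕ → S | (⨆ (t : ℕ) (_ : ω t ≠ sf), (t : ℕ∞)) < ⊤} := by
  have : {ω : ℕ → S | (⨆ (t : ℕ) (_ : ω t ≠ sf), (t : ℕ∞)) < ⊤} =
      ⋃ N : ℕ, ⋂ t : ℕ, ⋂ _ : N < t, (fun ω => ω t) ⁻¹' {sf} := by
    ext ω
    simp only [Set.mem_ofPred_eq, Set.mem_iUnion, Set.mem_iInter, Set.mem_preimage,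
      Set.mem_singleton_iff]
    constructor
    · intro h
      obtain ⟨N, hN⟩ := ENat.ne_top_iff_exists.1 h.ne
      refine ⟨N, fun t ht => ?_⟩
      by_contra hne
      have : (t : ℕ∞) ≤ N := hN ▸ le_iSup₂_of_le t hne le_rfl
      exact ht.not_ge (by exact_mod_cast this)
    · rintro ⟨N, hN⟩
      refine lt_of_le_of_lt (iSup₂_le fun t ht => ?_) (ENat.natCast_lt_top N)
      by_contra hlt
      exact ht (hN t (by exact_mod_cast not_le.1 hlt))
  rw [this]
  exact .iUnion fun N => .iInter fun t => .iInter fun _ =>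
    measurable_pi_apply t (measurableSet_singleton sf)

/-- Let `F` be an `R`-flow with `R(S*) > 0`, with forward policy `π` and
Markov chain `(s_t)` (of law `μ`, started at `s0`) with sampling time
`τ = sup {t | s_t ≠ sf}`, which is almost surely finite. Then the sampled state `s_τ` is
distributed proportionally to the reward: for every measurable `A ⊆ S*`,
`P(s_τ ∈ A) = R(A) / R(S*)`. -/
theorem sampled_state_proportional_to_reward
    {S : Type*} [MeasurableSpace S] [MeasurableSingletonClass S]
    (s0 sf : S) (hne : s0 ≠ sf)
    (F : Measure (S × S)) [IsFiniteMeasure F]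
    (hFsrc : F (Set.univ ×ˢ {s0}) = 0)
    (hFsnk : F ({sf} ×ˢ ({sf}ᶜ : Set S)) = 0)
    (R : Measure S) [IsFiniteMeasure R]
    (hRs0 : R {s0} = 0) (hRsf : R {sf} = 0)
    (hreward : ∀ A : Set S, MeasurableSet A → F (A ×ˢ {sf}) = R A)
    (hmatch : ∀ A : Set S, MeasurableSet A → A ⊆ ({s0, sf} : Set S)ᶜ →
      F.map Prod.snd A = F.map Prod.fst A)
    (hRpos : 0 < R (({s0, sf} : Set S)ᶜ))
    (π : Kernel S S) [IsMarkovKernel π]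
    (hπsink : π sf = Measure.dirac sf)
    (hπF : ∀ A B : Set S, MeasurableSet A → MeasurableSet B →
      F (A ×ˢ B) = ∫⁻ x in A, π x B ∂(F.map Prod.fst))
    (μ : Measure (ℕ → S)) [IsProbabilityMeasure μ]
    (hinit : μ {ω | ω 0 = s0} = 1)
    (hmarkov : ∀ (n : ℕ) (A : Set (ℕ → S)) (B : Set S),
      MeasurableSet[MeasurableSpace.comap
        (fun (ω : ℕ → S) (i : Fin (n + 1)) => ω i.val) inferInstance] A →
      MeasurableSet B →
      μ (A ∩ {ω | ω (n + 1) ∈ B}) = ∫⁻ ω in A, π (ω n) B ∂μ)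
    -- the sampling time `τ` is almost surely finite
    (hfin : μ {ω | (⨆ (t : ℕ) (_ : ω t ≠ sf), (t : ℕ∞)) < ⊤} = 1) :
    -- `P(s_τ ∈ A) = R(A) / R(S*)` for every measurable `A ⊆ S*`
    ∀ A : Set S, MeasurableSet A → A ⊆ ({s0, sf} : Set S)ᶜ →
      μ {ω | ∃ t : ℕ, ω t ∈ A ∧ ∀ t' : ℕ, t < t' → ω t' = sf} =
        R A / R (({s0, sf} : Set S)ᶜ) := by
  intro A hA hAsub
  have hmsf : MeasurableSet ({sf} : Set S) := measurableSet_singleton sf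
  have hms0 : MeasurableSet ({s0} : Set S) := measurableSet_singleton s0
  have hpair : MeasurableSet ({s0, sf} : Set S) := by measurability
  set G := F.map Prod.fst with hGdef
  have hfst (B : Set S) (hB : MeasurableSet B) : G B = F (B ×ˢ Set.univ) := by
    rw [hGdef, Measure.map_apply measurable_fst hB, Set.prod_univ]
  have hsnd (B : Set S) (hB : MeasurableSet B) : F.map Prod.snd B = F (Set.univ ×ˢ B) := by
    rw [Measure.map_apply measurable_snd hB, Set.univ_prod]
  have hGsf : G {sf} = 0 := by
    rw [hfst _ hmsf, ← Set.union_compl_self {sf}, Set.prod_union]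
    exact measure_union_null ((hreward _ hmsf).trans hRsf) hFsnk
  have hsrc : F.map Prod.snd {s0} = 0 := (hsnd _ hms0).trans hFsrc
  have hRpair : R ({s0, sf} : Set S) = 0 := by
    rw [Set.insert_eq]; exact measure_union_null hRs0 hRsf
  have hGs0 : G {s0} = R ({s0, sf} : Set S)ᶜ := by
    rw [edgeflow_source_mass hne hsrc hGsf (hmatch _ hpair.compl subset_rfl), hsnd _ hmsf,
      hreward _ .univ, ← measure_add_measure_compl hpair, hRpair, zero_add]
  set c := R ({s0, sf} : Set S)ᶜ with hc
  have hmeval (n : ℕ) : Measurable fun ω : ℕ → S => ω n := measurable_pi_apply n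
  let ν : ℕ → Measure S := fun n => μ.map fun ω => ω n
  have hνapp (n : ℕ) (B : Set S) (hB : MeasurableSet B) : ν n B = μ {ω | ω n ∈ B} :=
    Measure.map_apply (hmeval n) hB
  have hstep (n : ℕ) (A B : Set S) (hA : MeasurableSet A) (hB : MeasurableSet B) :
      μ {ω | ω n ∈ A ∧ ω (n + 1) ∈ B} = ∫⁻ x in A, π x B ∂ν n := by
    rw [setLIntegral_map hA (π.measurable_coe hB) (hmeval n)]
    exact hmarkov n {ω | ω n ∈ A} B
      ⟨{v | v (Fin.last n) ∈ A}, measurable_pi_apply (Fin.last n) hA, rfl⟩ hB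
  have h0ae : ∀ᵐ ω ∂μ, ω 0 = s0 :=
    (mem_ae_iff_prob_eq_one (hmeval 0 hms0)).2 hinit
  have hν0 : ν 0 = Measure.dirac s0 := by
    change μ.map (fun ω => ω 0) = _
    rw [Measure.map_congr (g := fun _ => s0) h0ae, Measure.map_const, measure_univ, one_smul]
  have hvisits (n : ℕ) : c • (∑ t ∈ Finset.range n, ν t).restrict {sf}ᶜ ≤ G := by
    refine smul_sum_restrict_le (π := π) (by rw [hπsink]; simp) hν0
      (fun n B hB => ?_) (fun B hB hsfB => ?_) n
    · simpa [hνapp _ _ hB] using hstep n Set.univ B .univ hB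
    · rw [← setLIntegral_univ, ← hπF _ _ .univ hB, ← hsnd _ hB, ← hGs0]
      have hdiff : F.map Prod.snd (B \ {s0}) = G (B \ {s0}) := by
        refine hmatch _ (hB.diff hms0) ?_
        rintro x ⟨hx, hx0⟩ (rfl | rfl)
        exacts [hx0 rfl, hsfB hx]
      rw [← measure_sdiff_null (s := B) hsrc, hdiff]
      by_cases h : s0 ∈ B
      · rw [Measure.dirac_apply_of_mem h, mul_one, ← measure_inter_add_sdiff B hms0,
          Set.inter_eq_right.2 (Set.singleton_subset_iff.2 h)]
      · rw [Measure.dirac_apply' _ hB]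
        simp [h]
  let E : Set S → Set (ℕ → S) := fun B => {ω | ∃ t, ω t ∈ B ∧ ∀ t', t < t' → ω t' = sf}
  have hupper (B : Set S) (hB : MeasurableSet B) (hsfB : sf ∉ B) : c * μ (E B) ≤ R B := by
    have hsub : B ⊆ {sf}ᶜ := fun x hx h => hsfB (h ▸ hx)
    have hE : E B ⊆ ⋃ t, {ω | ω t ∈ B ∧ ω (t + 1) ∈ ({sf} : Set S)} := by
      rintro ω ⟨t, ht, h⟩
      exact Set.mem_iUnion.2 ⟨t, ht, h _ t.lt_succ_self⟩
    have hsum : c * μ (E B) ≤ ∑' t, c * ∫⁻ x in B, π x {sf} ∂ν t := by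
      rw [ENNReal.tsum_mul_left]
      gcongr
      refine (measure_mono hE).trans ((measure_iUnion_le _).trans_eq ?_)
      exact tsum_congr fun t => hstep t B {sf} hB hmsf
    refine hsum.trans (ENNReal.tsum_le_of_sum_range_le fun n => ?_)
    calc ∑ t ∈ Finset.range n, c * ∫⁻ x in B, π x {sf} ∂ν t
        = ∫⁻ x in B, π x {sf} ∂(c • (∑ t ∈ Finset.range n, ν t).restrict {sf}ᶜ) := by
          rw [← Finset.mul_sum, Measure.restrict_smul, Measure.restrict_restrict hB,
            Set.inter_eq_left.2 hsub, lintegral_smul_measure, smul_eq_mul,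
            ← Measure.restrictₗ_apply, map_sum, lintegral_finsetSum_measure]
          simp only [Measure.restrictₗ_apply]
      _ ≤ ∫⁻ x in B, π x {sf} ∂G := by gcongr; exact hvisits n
      _ = R B := by rw [← hπF _ _ hB hmsf, hreward _ hB]
  have hcover : 1 ≤ μ (E A) + μ (E ({sf}ᶜ \ A)) := by
    have hae : E A ∪ E ({sf}ᶜ \ A) ∈ ae μ := by
      filter_upwards [h0ae,
        (mem_ae_iff_prob_eq_one (measurableSet_iSup_ne_lt_top sf)).2 hfin] with ω h0 hω
      obtain ⟨t, ht, hlast⟩ := exists_last_ne (h0 ▸ hne) hω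
      by_cases htA : ω t ∈ A
      · exact Or.inl ⟨t, htA, hlast⟩
      · exact Or.inr ⟨t, ⟨ht, htA⟩, hlast⟩
    calc 1 = μ (E A ∪ E ({sf}ᶜ \ A)) := by
          rw [measure_congr (eventuallyEq_univ.2 hae), measure_univ]
      _ ≤ _ := measure_union_le _ _
  have hsfA : sf ∉ A := fun h => hAsub h (by simp)
  have hAsf : A ⊆ {sf}ᶜ := fun x hx h => hsfA (h ▸ hx)
  have hc_top : c ≠ ⊤ := measure_ne_top _ _
  have hRdiff : R A + R ({sf}ᶜ \ A) = c := by
    rw [← Set.inter_eq_right.2 hAsf, Set.sdiff_self_inter, measure_inter_add_sdiff _ hA, hc,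
      ← measure_sdiff_null (s := {sf}ᶜ) hRs0]
    congr 1
    ext x
    simp [and_comm]
  have hlower : R A ≤ c * μ (E A) := by
    refine ENNReal.le_of_add_le_add_right (measure_ne_top R ({sf}ᶜ \ A)) ?_
    calc R A + R ({sf}ᶜ \ A) = c * 1 := by rw [hRdiff, mul_one]
      _ ≤ c * (μ (E A) + μ (E ({sf}ᶜ \ A))) := by gcongr
      _ ≤ c * μ (E A) + R ({sf}ᶜ \ A) := by
          rw [mul_add]
          gcongr
          exact hupper _ (hmsf.compl.diff hA) (by simp)
  rw [ENNReal.eq_div_iff hRpos.ne' hc_top]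
  exact le_antisymm (hupper A hA hsfA) hlower
end

section
/- Let F be an R-edgeflow on S with forward policy π_f. Then F satisfies the flow-matching constraint (i.e. F is an R-flow) if and only if, as signed measures on S, F_out π_f − F_out = R(S*)·δ_{sf} − F_out({s0})·δ_{s0}. -/
open MeasureTheory ProbabilityTheory Filter
open scoped ENNReal

/-- Two measures that agree at two points and on every measurable set avoiding both are equal. -/
theorem measure_ext_of_pair_compl {S : Type*} [MeasurableSpace S] [MeasurableSingletonClass S]
    {a b : S} {μ ν : Measure S} (ha : μ {a} = ν {a}) (hb : μ {b} = ν {b})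
    (hc : ∀ A : Set S, MeasurableSet A → A ⊆ ({a, b} : Set S)ᶜ → μ A = ν A) : μ = ν := by
  have h_inter (c : S) (h : μ {c} = ν {c}) (A : Set S) : μ (A ∩ {c}) = ν (A ∩ {c}) := by
    by_cases hA : c ∈ A
    · rwa [Set.inter_eq_right.2 (Set.singleton_subset_iff.2 hA)]
    · simp [Set.inter_singleton_eq_empty.2 hA]
  ext A hA
  rw [← measure_inter_add_sdiff (μ := μ) A (measurableSet_singleton a),
    ← measure_inter_add_sdiff (μ := ν) A (measurableSet_singleton a),
    ← measure_inter_add_sdiff (μ := μ) (A \ {a}) (measurableSet_singleton b),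
    ← measure_inter_add_sdiff (μ := ν) (A \ {a}) (measurableSet_singleton b),
    h_inter a ha, h_inter b hb, hc]
  · measurability
  · rintro x ⟨⟨-, hxa⟩, hxb⟩ (h | h)
    exacts [hxa h, hxb h]

/-- Let `F` be an `R`-edgeflow with forward policy `π`. Then `F` satisfies
the flow-matching constraint (i.e. `F` is an `R`-flow) if and only if, as (signed) measures
on `S`, `F_out π − F_out = R(S*) δ_{sf} − F_out({s0}) δ_{s0}`; since all measures involved
are finite and nonnegative this equality of signed measures is stated in the rearranged form
`F_out π + F_out({s0}) δ_{s0} = F_out + R(S*) δ_{sf}`. -/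
theorem flow_matching_iff_recurrence
    {S : Type*} [MeasurableSpace S] [MeasurableSingletonClass S]
    (s0 sf : S) (hne : s0 ≠ sf)
    -- `F` is an edgeflow
    (F : Measure (S × S)) [IsFiniteMeasure F]
    (hFsrc : F (Set.univ ×ˢ {s0}) = 0)
    (hFsnk : F ({sf} ×ˢ ({sf}ᶜ : Set S)) = 0)
    -- the reward measure `R`
    (R : Measure S) [IsFiniteMeasure R]
    (hRs0 : R {s0} = 0) (hRsf : R {sf} = 0)
    -- `F` is an `R`-edgeflow
    (hreward : ∀ A : Set S, MeasurableSet A → F (A ×ˢ {sf}) = R A)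
    -- `π` is a forward policy of `F`
    (π : Kernel S S) [IsMarkovKernel π]
    (hπsink : π sf = Measure.dirac sf)
    (hπF : ∀ A B : Set S, MeasurableSet A → MeasurableSet B →
      F (A ×ˢ B) = ∫⁻ x in A, π x B ∂(F.map Prod.fst)) :
    -- flow matching holds iff `F_out π − F_out = R(S*) δ_{sf} − F_out({s0}) δ_{s0}`
    (∀ A : Set S, MeasurableSet A → A ⊆ ({s0, sf} : Set S)ᶜ →
      F.map Prod.snd A = F.map Prod.fst A) ↔
    (F.map Prod.fst).bind (fun x => π x) + (F.map Prod.fst) {s0} • Measure.dirac s0 =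
      F.map Prod.fst + R (({s0, sf} : Set S)ᶜ) • Measure.dirac sf := by
  have hbind : (F.map Prod.fst).bind (fun x => π x) = F.map Prod.snd := by
    ext A hA
    rw [Measure.bind_apply hA π.measurable.aemeasurable, Measure.map_apply measurable_snd hA,
      ← Set.univ_prod, hπF _ _ MeasurableSet.univ hA, Measure.restrict_univ]
  have hin_s0 : F.map Prod.snd {s0} = 0 := by
    rwa [Measure.map_apply measurable_snd (measurableSet_singleton s0), ← Set.univ_prod]
  have hpair : R ({s0, sf} : Set S) = 0 := measure_union_null hRs0 hRsf
  have hin_sf : F.map Prod.snd {sf} = R (({s0, sf} : Set S)ᶜ) := by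
    rw [Measure.map_apply measurable_snd (measurableSet_singleton sf), ← Set.univ_prod,
      hreward _ MeasurableSet.univ,
      ← measure_add_measure_compl (μ := R) (((Set.finite_singleton sf).insert s0).measurableSet),
      hpair, zero_add]
  have hout_sf : F.map Prod.fst {sf} = 0 := by
    rw [Measure.map_apply measurable_fst (measurableSet_singleton sf), ← Set.prod_univ,
      ← Set.union_compl_self {sf}, Set.prod_union]
    exact measure_union_null ((hreward _ (measurableSet_singleton sf)).trans hRsf) hFsnk
  rw [hbind]
  constructor
  · intro h
    refine measure_ext_of_pair_compl (a := s0) (b := sf) ?_ ?_ fun A hA hAsub => ?_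
    · simp [hin_s0, hne.symm]
    · simp [hin_sf, hout_sf, hne]
    · have hs0 : s0 ∉ A := fun hx => hAsub hx (by simp)
      have hsf : sf ∉ A := fun hx => hAsub hx (by simp)
      simp only [Measure.add_apply, Measure.smul_apply, Measure.dirac_apply' _ hA,
        Set.indicator_of_notMem hs0, Set.indicator_of_notMem hsf, smul_zero, add_zero]
      exact h A hA hAsub
  · intro h A hA hAsub
    have hs0 : s0 ∉ A := fun hx => hAsub hx (by simp)
    have hsf : sf ∉ A := fun hx => hAsub hx (by simp)
    have hAeq := congrArg (fun μ : Measure S => μ A) h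
    simpa only [Measure.add_apply, Measure.smul_apply, Measure.dirac_apply' _ hA,
      Set.indicator_of_notMem hs0, Set.indicator_of_notMem hsf, smul_zero, add_zero] using hAeq
end

section
/- Let F be an R-flow on S with R(S*) > 0, with forward policy π_f and sampling time τ, and let F̄ be its sampler flow (F̄_out(A) := F_out({s0}) · E(card{t : s_t ∈ A, s_t ≠ sf})). Then the expected sampling time satisfies E(τ) = F̄_out(S*)/R(S*) ≤ F_out(S*)/R(S*); in particular the total outgoing flow on S* bounds the expected sampling time. -/
open MeasureTheory ProbabilityTheory Filter
open scoped ENNReal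

/-- The supremum of an initial segment of `ℕ`, counted through its nonzero elements. -/
lemma ENNReal.iSup_natCast_eq_tsum_of_initial {p : ℕ → Prop} (hp : ∀ n, p (n + 1) → p n) :
    (⨆ (t : ℕ) (_ : p t), (t : ℝ≥0∞)) =
      ∑' t : ℕ, Set.indicator {t' : ℕ | p (t' + 1)} (fun _ => (1 : ℝ≥0∞)) t := by
  have hle : ∀ m n, m ≤ n → p n → p m := fun m n hmn =>
    Nat.le_induction (P := fun n _ => p n → p m) id (fun n _ ih h => ih (hp n h)) n hmn
  apply le_antisymm
  · refine iSup₂_le fun t ht => ?_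
    calc (t : ℝ≥0∞)
        = ∑ i ∈ Finset.range t, Set.indicator {t' : ℕ | p (t' + 1)} (fun _ => (1 : ℝ≥0∞)) i := by
          rw [Finset.sum_congr rfl fun i hi => Set.indicator_of_mem
            (show i ∈ {t' : ℕ | p (t' + 1)} from hle _ _ (Finset.mem_range.mp hi) ht) _]
          simp
      _ ≤ _ := ENNReal.sum_le_tsum _
  · refine ENNReal.tsum_le_of_sum_range_le fun n => ?_
    induction n with
    | zero => simp
    | succ n ih =>
      by_cases h : p (n + 1)
      · refine le_trans ?_ (le_iSup₂ (f := fun (t : ℕ) (_ : p t) => (t : ℝ≥0∞)) (n + 1) h)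
        calc _ ≤ ∑ _i ∈ Finset.range (n + 1), (1 : ℝ≥0∞) :=
              Finset.sum_le_sum fun i _ => Set.indicator_le_self' (fun _ _ => zero_le) i
          _ = _ := by simp
      · rw [Finset.sum_range_succ, Set.indicator_of_notMem (by simpa using h), add_zero]
        exact ih

/-- The occupation measure of a chain killed outside `C` is dominated by every measure `ρ` that
is superharmonic for the killed kernel with initial mass `lam 0`. -/
lemma MeasureTheory.Measure.sum_range_le_of_killed_step {S : Type*} [MeasurableSpace S]
    {κ : Kernel S S} {C : Set S} {lam : ℕ → Measure S} {ρ : Measure S}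
    (hstep : ∀ n B, MeasurableSet B → lam (n + 1) B = ∫⁻ x, κ x (B ∩ C) ∂lam n)
    (hρ : ∀ B, MeasurableSet B → lam 0 B + ∫⁻ x, κ x (B ∩ C) ∂ρ ≤ ρ B) (n : ℕ) :
    ∑ i ∈ Finset.range n, lam i ≤ ρ := by
  induction n with
  | zero => exact Measure.zero_le ρ
  | succ n ih =>
    refine Measure.le_iff.mpr fun B hB => ?_
    calc (∑ i ∈ Finset.range (n + 1), lam i) B
        = lam 0 B + ∫⁻ x, κ x (B ∩ C) ∂(∑ i ∈ Finset.range n, lam i) := by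
          rw [Finset.sum_range_succ', add_comm, Measure.add_apply, Measure.finsetSum_apply,
            lintegral_finsetSum_measure]
          simp only [hstep _ B hB]
      _ ≤ lam 0 B + ∫⁻ x, κ x (B ∩ C) ∂ρ := by gcongr
      _ ≤ ρ B := hρ B hB

/-- Let `F` be an `R`-flow with `R(S*) > 0`, with forward policy `π`, Markov
chain `(s_t)` (of law `μ`, started at `s0`) and sampling time `τ = sup {t | s_t ≠ sf}`, and let
`F̄` be its sampler flow, `F̄_out(A) := F_out({s0}) · E(card {t | s_t ∈ A, s_t ≠ sf})`.
Then `E(τ) = F̄_out(S*) / R(S*) ≤ F_out(S*) / R(S*)`: the total outgoing flow on `S*`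
bounds the expected sampling time. -/
theorem expected_sampling_time_bound
    {S : Type*} [MeasurableSpace S] [MeasurableSingletonClass S]
    (s0 sf : S) (hne : s0 ≠ sf)
    (F : Measure (S × S)) [IsFiniteMeasure F]
    (hFsrc : F (Set.univ ×ˢ {s0}) = 0)
    (hFsnk : F ({sf} ×ˢ ({sf}ᶜ : Set S)) = 0)
    (R : Measure S) [IsFiniteMeasure R]
    (hRs0 : R {s0} = 0) (hRsf : R {sf} = 0)
    (hreward : ∀ A : Set S, MeasurableSet A → F (A ×ˢ {sf}) = R A)
    (hmatch : ∀ A : Set S, MeasurableSet A → A ⊆ ({s0, sf} : Set S)ᶜ →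
      F.map Prod.snd A = F.map Prod.fst A)
    (hRpos : 0 < R (({s0, sf} : Set S)ᶜ))
    (π : Kernel S S) [IsMarkovKernel π]
    (hπsink : π sf = Measure.dirac sf)
    (hπF : ∀ A B : Set S, MeasurableSet A → MeasurableSet B →
      F (A ×ˢ B) = ∫⁻ x in A, π x B ∂(F.map Prod.fst))
    (μ : Measure (ℕ → S)) [IsProbabilityMeasure μ]
    (hinit : μ {ω | ω 0 = s0} = 1)
    (hmarkov : ∀ (n : ℕ) (A : Set (ℕ → S)) (B : Set S),
      MeasurableSet[MeasurableSpace.comap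
        (fun (ω : ℕ → S) (i : Fin (n + 1)) => ω i.val) inferInstance] A →
      MeasurableSet B →
      μ (A ∩ {ω | ω (n + 1) ∈ B}) = ∫⁻ ω in A, π (ω n) B ∂μ)
    -- `F̄_out` is the outgoing flow of the sampler flow
    (barFout : Measure S)
    (hbarFout : ∀ A : Set S, MeasurableSet A →
      barFout A = (F.map Prod.fst) {s0} *
        ∫⁻ ω, ∑' t : ℕ,
          Set.indicator {t' : ℕ | ω t' ∈ A ∧ ω t' ≠ sf} (fun _ => (1 : ℝ≥0∞)) t ∂μ) :
    -- `E(τ) = F̄_out(S*) / R(S*) ≤ F_out(S*) / R(S*)`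
    (∫⁻ ω, (⨆ (t : ℕ) (_ : ω t ≠ sf), (t : ℝ≥0∞)) ∂μ) =
      barFout (({s0, sf} : Set S)ᶜ) / R (({s0, sf} : Set S)ᶜ) ∧
    barFout (({s0, sf} : Set S)ᶜ) / R (({s0, sf} : Set S)ᶜ) ≤
      (F.map Prod.fst) (({s0, sf} : Set S)ᶜ) / R (({s0, sf} : Set S)ᶜ) := by
  set C : Set S := {sf}ᶜ with hCdef
  set T : Set S := ({s0, sf} : Set S)ᶜ with hTdef
  set ρ : Measure S := F.map Prod.fst with hρdef
  have hC : MeasurableSet C := (measurableSet_singleton sf).compl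
  have hT : MeasurableSet T := ((measurableSet_singleton sf).insert s0).compl
  have hunivT : (Set.univ : Set S) = T ∪ ({s0} ∪ {sf}) := by
    ext x; simp [hTdef]; tauto
  have hdisj : Disjoint ({s0} : Set S) {sf} := by simpa using hne
  have hdisjT : Disjoint T ({s0} ∪ {sf}) := by
    rw [hTdef, Set.insert_eq]; exact disjoint_compl_left
  have hms : MeasurableSet ({s0} ∪ {sf} : Set S) :=
    (measurableSet_singleton s0).union (measurableSet_singleton sf)
  have hsplit : ∀ M : Measure S, M Set.univ = M T + (M {s0} + M {sf}) := fun M => by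
    rw [hunivT, measure_union hdisjT hms, measure_union hdisj (measurableSet_singleton sf)]
  have : IsFiniteMeasure ρ := by rw [hρdef]; infer_instance
  have hsnd : ∀ B : Set S, MeasurableSet B → F.map Prod.snd B = ∫⁻ x, π x B ∂ρ := by
    intro B hB
    have h := hπF Set.univ B MeasurableSet.univ hB
    rw [Measure.restrict_univ] at h
    rw [← h, Measure.map_apply measurable_snd hB, Set.univ_prod]
  have hsnd0 : ∫⁻ x, π x {s0} ∂ρ = 0 := by
    rw [← hsnd _ (measurableSet_singleton s0),
      Measure.map_apply measurable_snd (measurableSet_singleton s0), ← Set.univ_prod, hFsrc]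
  have hρsf : ρ {sf} = 0 := by
    rw [hρdef, Measure.map_apply measurable_fst (measurableSet_singleton sf), ← Set.prod_univ,
      ← Set.union_compl_self {sf}, Set.prod_union]
    exact measure_union_null (by rw [hreward _ (measurableSet_singleton sf), hRsf]) hFsnk
  have hRm : R T = ρ {s0} := by
    have h1 : R Set.univ = R T := by rw [hsplit, hRs0, hRsf]; simp
    have h2 : F.map Prod.snd {sf} = R T := by
      rw [← h1, ← hreward _ MeasurableSet.univ,
        Measure.map_apply measurable_snd (measurableSet_singleton sf), Set.univ_prod]
    have h3 : F.map Prod.snd Set.univ = ρ Set.univ := by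
      rw [hρdef, Measure.map_apply measurable_snd MeasurableSet.univ,
        Measure.map_apply measurable_fst MeasurableSet.univ, Set.preimage_univ, Set.preimage_univ]
    rw [hsplit, hsplit, hρsf, h2, hsnd _ (measurableSet_singleton s0), hsnd0,
      hmatch T hT subset_rfl, zero_add, add_zero] at h3
    exact (ENNReal.add_right_inj (measure_ne_top ρ T)).mp h3
  have hm0 : ρ {s0} ≠ 0 := hRm ▸ hRpos.ne'
  have hmtop : ρ {s0} ≠ ∞ := measure_ne_top ρ _
  have heval : ∀ n, Measurable fun ω : ℕ → S => ω n := measurable_pi_apply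
  have hinit' : ∀ᵐ ω ∂μ, ω 0 = s0 :=
    (prob_compl_eq_zero_iff (heval 0 (measurableSet_singleton s0))).mpr hinit
  have habs : ∀ᵐ ω ∂μ, ∀ n, ω n = sf → ω (n + 1) = sf := by
    refine ae_all_iff.mpr fun n => ?_
    have hA : MeasurableSet[MeasurableSpace.comap
        (fun (ω : ℕ → S) (i : Fin (n + 1)) => ω i.val) inferInstance] {ω : ℕ → S | ω n = sf} :=
      ⟨(fun v => v (Fin.last n)) ⁻¹' {sf},
        measurable_pi_apply (Fin.last n) (measurableSet_singleton sf), rfl⟩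
    have h := hmarkov n {ω | ω n = sf} C hA hC
    have hzero : ∫⁻ ω in {ω | ω n = sf}, π (ω n) C ∂μ = 0 := by
      rw [setLIntegral_congr_fun (s := {ω : ℕ → S | ω n = sf}) (g := fun _ => 0)
        (heval n (measurableSet_singleton sf)) (fun ω hω => ?_), lintegral_zero]
      rw [Set.mem_ofPred_eq] at hω
      simp only [hω, hπsink, Measure.dirac_apply' sf hC]
      simp [hCdef]
    rw [hzero] at h
    rw [ae_iff]
    convert h using 2
    ext ω
    simp [hCdef]
  set lam : ℕ → Measure S := fun n => ρ {s0} • (μ.map fun ω => ω n).restrict C with hlam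
  have hlam_apply : ∀ n B, MeasurableSet B → lam n B = ρ {s0} * μ {ω | ω n ∈ B ∩ C} := by
    intro n B hB
    rw [hlam]
    simp only [Measure.smul_apply, smul_eq_mul]
    rw [Measure.restrict_apply hB, Measure.map_apply (heval n) (hB.inter hC)]
    rfl
  have hstep : ∀ n B, MeasurableSet B → lam (n + 1) B = ∫⁻ x, π x (B ∩ C) ∂lam n := by
    intro n B hB
    have h := hmarkov n Set.univ (B ∩ C) MeasurableSet.univ (hB.inter hC)
    rw [Set.univ_inter, Measure.restrict_univ] at h
    rw [hlam_apply _ _ hB, h, hlam]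
    simp only [lintegral_smul_measure, smul_eq_mul]
    congr 1
    have hk : Measurable fun x => π x (B ∩ C) := π.measurable_coe (hB.inter hC)
    rw [← lintegral_map hk (heval n), ← lintegral_add_compl _ hC]
    have : ∫⁻ x in Cᶜ, π x (B ∩ C) ∂(μ.map fun ω => ω n) = 0 := by
      rw [setLIntegral_congr_fun (g := fun _ => 0) hC.compl (fun x hx => ?_), lintegral_zero]
      have hx' : x = sf := by simpa [hCdef] using hx
      simp only [hx', hπsink, Measure.dirac_apply' sf (hB.inter hC)]
      simp [hCdef]
    rw [this, add_zero]
  have hsuper : ∀ B, MeasurableSet B → lam 0 B + ∫⁻ x, π x (B ∩ C) ∂ρ ≤ ρ B := by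
    intro B hB
    have hBC := hB.inter hC
    have hBT := hB.inter hT
    have h0 : lam 0 B ≤ ρ (B ∩ {s0}) := by
      rw [hlam_apply 0 B hB]
      by_cases hs : s0 ∈ B
      · rw [Set.inter_eq_right.mpr (Set.singleton_subset_iff.mpr hs)]
        exact mul_le_of_le_one_right' prob_le_one
      · have : μ {ω | ω 0 ∈ B ∩ C} = 0 := by
          refine measure_mono_null (fun ω hω => ?_) (ae_iff.mp hinit')
          rintro h
          exact hs (h ▸ hω.1)
        rw [this, mul_zero]
        exact zero_le
    have h1 : ∫⁻ x, π x (B ∩ C) ∂ρ ≤ ρ (B ∩ T) := by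
      calc ∫⁻ x, π x (B ∩ C) ∂ρ
          ≤ ∫⁻ x, π x {s0} + π x (B ∩ T) ∂ρ := by
            refine lintegral_mono fun x => (measure_mono ?_).trans (measure_union_le _ _)
            rintro y ⟨hyB, hyC⟩
            by_cases hy : y = s0
            · exact Or.inl hy
            · exact Or.inr ⟨hyB, by simp_all⟩
        _ = ρ (B ∩ T) := by
            rw [lintegral_add_left (π.measurable_coe (measurableSet_singleton s0)), hsnd0, zero_add,
              ← hsnd _ hBT, hmatch _ hBT Set.inter_subset_right]
    calc _ ≤ ρ (B ∩ {s0}) + ρ (B ∩ T) := add_le_add h0 h1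
      _ = ρ ((B ∩ {s0}) ∪ (B ∩ T)) := by
          refine (measure_union ?_ hBT).symm
          refine Set.disjoint_left.mpr fun x hx hx' => ?_
          have := hx.2
          have := hx'.2
          simp_all
      _ ≤ ρ B := measure_mono (Set.union_subset Set.inter_subset_left Set.inter_subset_left)
  have hocc := Measure.sum_range_le_of_killed_step hstep hsuper
  have hreturn : ∀ᵐ ω ∂μ, ∀ n, ω (n + 1) ≠ s0 := by
    refine ae_all_iff.mpr fun n => ?_
    have hlamn : lam n ≤ ρ := by
      refine le_trans ?_ (hocc (n + 1))
      rw [Finset.sum_range_succ]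
      exact Measure.le_add_left le_rfl
    have hsC : ({s0} : Set S) ∩ C = {s0} :=
      Set.inter_eq_left.mpr (Set.singleton_subset_iff.mpr hne)
    have h : lam (n + 1) {s0} = 0 := by
      rw [hstep n _ (measurableSet_singleton s0), hsC]
      exact le_antisymm ((lintegral_mono' hlamn le_rfl).trans hsnd0.le) zero_le
    rw [hlam_apply _ _ (measurableSet_singleton s0), hsC] at h
    rw [ae_iff]
    simpa [hm0] using h
  have hτ : ∫⁻ ω, (⨆ (t : ℕ) (_ : ω t ≠ sf), (t : ℝ≥0∞)) ∂μ = ∫⁻ ω, ∑' t : ℕ,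
      Set.indicator {t' : ℕ | ω t' ∈ T ∧ ω t' ≠ sf} (fun _ => (1 : ℝ≥0∞)) t ∂μ := by
    refine lintegral_congr_ae ?_
    filter_upwards [hinit', habs, hreturn] with ω h0 ha hr
    rw [ENNReal.iSup_natCast_eq_tsum_of_initial (p := fun t => ω t ≠ sf) fun n => mt (ha n),
      tsum_eq_zero_add' (M := ℝ≥0∞)
        (f := fun t => Set.indicator {t' : ℕ | ω t' ∈ T ∧ ω t' ≠ sf} (fun _ => (1 : ℝ≥0∞)) t)
        ENNReal.summable, Set.indicator_of_notMem (by simp [h0, hTdef]), zero_add]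
    refine tsum_congr fun t => ?_
    classical
    simp only [Set.indicator_apply]
    refine if_congr ?_ rfl rfl
    simp [hTdef, hr t]
  have hbar : barFout T = ∑' t, lam t T := by
    rw [hbarFout T hT, lintegral_tsum, ← ENNReal.tsum_mul_left]
    · refine tsum_congr fun t => ?_
      rw [hlam_apply t T hT]
      exact congrArg _ (lintegral_indicator_one (heval t (hT.inter hC)))
    · intro t
      exact (measurable_one.indicator (heval t (hT.inter hC))).aemeasurable
  refine ⟨?_, ENNReal.div_le_div_right ?_ _⟩
  · rw [hτ, hbarFout T hT, hRm, mul_comm, ENNReal.mul_div_cancel_right hm0 hmtop]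
  · rw [hbar]
    refine ENNReal.tsum_le_of_sum_range_le fun n => ?_
    rw [← Measure.finsetSum_apply]
    exact hocc n T
end

section
/- Every edgeflow F on S admits a maximal 0-subflow F0, i.e. a 0-subflow of F that is maximal among 0-subflows of F for the setwise order on measures; consequently F decomposes as F = F0 + F_min, where F_min := F − F0 is an edgeflow admitting no nontrivial 0-subflow (a minimal edgeflow). -/
open MeasureTheory Filter
open scoped ENNReal

variable {S : Type*} [MeasurableSpace S]

/-- An edgeflow: a finite nonnegative measure on `S × S` with no mass into the source `s0`
and no mass out of the sink `sf` (except the self-loop at `sf`). -/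
def IsEdgeflow (s0 sf : S) (F : Measure (S × S)) : Prop :=
  IsFiniteMeasure F ∧ F (Set.univ ×ˢ {s0}) = 0 ∧ F ({sf} ×ˢ ({sf}ᶜ : Set S)) = 0

/-- A `0`-flow: an edgeflow satisfying the flow-matching constraint on `S* = {s0, sf}ᶜ`
and carrying no mass into the sink, `F(S × {sf}) = 0`. -/
def IsZeroFlow (s0 sf : S) (F : Measure (S × S)) : Prop :=
  IsEdgeflow s0 sf F ∧
  (∀ A : Set S, MeasurableSet A → A ⊆ ({s0, sf} : Set S)ᶜ →
    F.map Prod.snd A = F.map Prod.fst A) ∧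
  F (Set.univ ×ˢ {sf}) = 0

theorem IsEdgeflow.mono {s0 sf : S} {F G : Measure (S × S)} (hF : IsEdgeflow s0 sf F)
    (h : G ≤ F) : IsEdgeflow s0 sf G := by
  obtain ⟨hfin, h0, hf⟩ := hF
  exact ⟨isFiniteMeasure_of_le F h, le_antisymm (h0 ▸ h _) zero_le, le_antisymm (hf ▸ h _) zero_le⟩

theorem isZeroFlow_zero (s0 sf : S) : IsZeroFlow s0 sf 0 :=
  ⟨⟨inferInstance, by simp, by simp⟩, by simp, by simp⟩

theorem IsZeroFlow.sub {s0 sf : S} {F G : Measure (S × S)} (hF : IsZeroFlow s0 sf F)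
    (hG : IsZeroFlow s0 sf G) (h : G ≤ F) : IsZeroFlow s0 sf (F - G) := by
  have := hF.1.1
  have := hG.1.1
  refine ⟨hF.1.mono Measure.sub_le, fun A hA hAs => ?_,
    le_antisymm (hF.2.2 ▸ Measure.sub_le _) zero_le⟩
  have key := hF.2.1 A hA hAs
  rw [← Measure.sub_add_cancel_of_le h, Measure.map_add _ _ measurable_snd,
    Measure.map_add _ _ measurable_fst, Measure.add_apply, Measure.add_apply,
    hG.2.1 A hA hAs] at key
  exact (ENNReal.add_left_inj (measure_ne_top _ _)).1 key

/-- A countable sum of `0`-flows dominated by an edgeflow is a `0`-flow. -/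
theorem IsZeroFlow.sum [MeasurableSingletonClass S] {s0 sf : S} {ι : Type*} [Countable ι]
    {H : ι → Measure (S × S)} (hH : ∀ i, IsZeroFlow s0 sf (H i))
    (hsum : IsEdgeflow s0 sf (Measure.sum H)) : IsZeroFlow s0 sf (Measure.sum H) := by
  refine ⟨hsum, fun A hA hAs => ?_, ?_⟩
  · rw [Measure.map_apply measurable_snd hA, Measure.map_apply measurable_fst hA,
      Measure.sum_apply _ (measurable_snd hA), Measure.sum_apply _ (measurable_fst hA)]
    refine tsum_congr fun i => ?_
    have := (hH i).2.1 A hA hAs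
    rwa [Measure.map_apply measurable_snd hA, Measure.map_apply measurable_fst hA] at this
  · rw [Measure.sum_apply _ (MeasurableSet.univ.prod (measurableSet_singleton sf))]
    simp [fun i => (hH i).2.2]

/-- A finite measure has a `0`-subflow whose mass is at least half the mass of any other. -/
theorem exists_isZeroFlow_le_half_mass (s0 sf : S) (μ : Measure (S × S)) [IsFiniteMeasure μ] :
    ∃ H, IsZeroFlow s0 sf H ∧ H ≤ μ ∧
      ∀ G, IsZeroFlow s0 sf G → G ≤ μ → G Set.univ ≤ 2 * H Set.univ := by
  set a : ℝ≥0∞ := ⨆ G : {G : Measure (S × S) // IsZeroFlow s0 sf G ∧ G ≤ μ}, G.1 Set.univ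
    with ha
  have hle : ∀ G, IsZeroFlow s0 sf G → G ≤ μ → G Set.univ ≤ a := fun G hG hGμ =>
    le_iSup (fun G : {G : Measure (S × S) // IsZeroFlow s0 sf G ∧ G ≤ μ} => G.1 Set.univ)
      ⟨G, hG, hGμ⟩
  rcases eq_or_ne a 0 with h0 | h0
  · exact ⟨0, isZeroFlow_zero s0 sf, Measure.zero_le μ, fun G hG hGμ =>
      (hle G hG hGμ).trans (by simp [h0])⟩
  · have hatop : a ≠ ∞ :=
      ne_top_of_le_ne_top (measure_ne_top μ Set.univ) (iSup_le fun G => G.2.2 Set.univ)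
    obtain ⟨⟨H, hH, hHμ⟩, hlt⟩ := lt_iSup_iff.1 (ENNReal.half_lt_self h0 hatop)
    refine ⟨H, hH, hHμ, fun G hG hGμ => (hle G hG hGμ).trans ?_⟩
    calc a = 2 * (a / 2) := (ENNReal.mul_div_cancel two_ne_zero ENNReal.ofNat_ne_top).symm
      _ ≤ 2 * H Set.univ := by gcongr

/-- Every edgeflow has a `0`-subflow whose complement has no nontrivial `0`-subflow. -/
theorem IsEdgeflow.exists_isZeroFlow_sub_minimal [MeasurableSingletonClass S] {s0 sf : S}
    {F : Measure (S × S)} (hF : IsEdgeflow s0 sf F) :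
    ∃ F0, IsZeroFlow s0 sf F0 ∧ F0 ≤ F ∧
      ∀ G, IsZeroFlow s0 sf G → G ≤ F - F0 → G = 0 := by
  have hfin := hF.1
  have step : ∀ μ : {μ : Measure (S × S) // IsFiniteMeasure μ}, ∃ H, IsZeroFlow s0 sf H ∧
      H ≤ μ.1 ∧ ∀ G, IsZeroFlow s0 sf G → G ≤ μ.1 → G Set.univ ≤ 2 * H Set.univ := fun μ =>
    have := μ.2
    exists_isZeroFlow_le_half_mass s0 sf μ.1
  choose H hH hHle hHmax using step
  let R : ℕ → {μ : Measure (S × S) // IsFiniteMeasure μ} := fun n =>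
    Nat.rec ⟨F, hfin⟩ (fun _ μ => ⟨μ.1 - H μ, have := μ.2; inferInstance⟩) n
  have hR : ∀ n, (R n).1 + ∑ k ∈ Finset.range n, H (R k) = F := by
    intro n
    induction n with
    | zero => simp [R]
    | succ n ih =>
      have := (hH (R n)).1.1
      have hsub : (R (n + 1)).1 + H (R n) = (R n).1 := Measure.sub_add_cancel_of_le (hHle (R n))
      rw [Finset.sum_range_succ, add_comm (Finset.sum _ _), ← add_assoc, hsub, ih]
  have hle : Measure.sum (fun n => H (R n)) ≤ F := by
    refine Measure.le_iff.2 fun s hs => ?_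
    rw [Measure.sum_apply _ hs]
    refine ENNReal.tsum_le_of_sum_range_le fun n => ?_
    rw [← Measure.finsetSum_apply]
    calc _ ≤ ((R n).1 + ∑ k ∈ Finset.range n, H (R k)) s := by
          rw [Measure.add_apply]; exact le_add_self
      _ = F s := by rw [hR n]
  have hedge := hF.mono hle
  have := hedge.1
  refine ⟨_, IsZeroFlow.sum (fun n => hH (R n)) hedge, hle, fun G hG hGle => ?_⟩
  have hGR : ∀ n, G ≤ (R n).1 := fun n => by
    refine hGle.trans (Measure.sub_le_of_le_add ?_)
    refine Measure.le_iff.2 fun s hs => ?_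
    rw [← hR n, Measure.add_apply, Measure.add_apply, Measure.sum_apply _ hs,
      Measure.finsetSum_apply]
    gcongr
    exact ENNReal.sum_le_tsum _
  have hlim : Tendsto (fun n => 2 * H (R n) Set.univ) atTop (nhds (2 * 0)) := by
    refine ENNReal.Tendsto.const_mul (ENNReal.tendsto_atTop_zero_of_tsum_ne_top ?_)
      (Or.inr ENNReal.ofNat_ne_top)
    rw [← Measure.sum_apply _ MeasurableSet.univ]
    exact measure_ne_top _ _
  rw [mul_zero] at hlim
  exact Measure.measure_univ_eq_zero.1 <| le_antisymm
    (ge_of_tendsto' hlim fun n => hHmax (R n) G hG (hGR n)) zero_le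

/-- Every edgeflow `F` admits a maximal `0`-subflow `F0`, and hence
decomposes as `F = F0 + F_min` with `F_min` a minimal edgeflow (one admitting no
nontrivial `0`-subflow). -/
theorem exists_maximal_zero_subflow [MeasurableSingletonClass S]
    (s0 sf : S) (hne : s0 ≠ sf)
    (F : Measure (S × S)) (hF : IsEdgeflow s0 sf F) :
    ∃ F0 Fmin : Measure (S × S),
      -- `F0` is a `0`-subflow of `F` ...
      IsZeroFlow s0 sf F0 ∧ F0 ≤ F ∧
      -- ... maximal among `0`-subflows of `F` for the setwise order on measures
      (∀ G : Measure (S × S), IsZeroFlow s0 sf G → G ≤ F → F0 ≤ G → G = F0) ∧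
      -- and `F = F0 + F_min` where `F_min` is a minimal edgeflow
      F = F0 + Fmin ∧ IsEdgeflow s0 sf Fmin ∧
      (∀ G : Measure (S × S), IsZeroFlow s0 sf G → G ≤ Fmin → G = 0) := by
  obtain ⟨F0, hF0, hle, hmin⟩ := hF.exists_isZeroFlow_sub_minimal
  have := hF.1
  have := hF0.1.1
  refine ⟨F0, F - F0, hF0, hle, fun G hG hGF hG0 => ?_, ?_, hF.mono Measure.sub_le, hmin⟩
  · have hzero : G - F0 = 0 := hmin _ (hG.sub hF0 hG0) <| by
      refine Measure.sub_le_of_le_add ?_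
      rwa [Measure.sub_add_cancel_of_le hle]
    rw [← Measure.sub_add_cancel_of_le hG0, hzero, zero_add]
  · rw [add_comm, Measure.sub_add_cancel_of_le hle]
end

section
/- Let G = (S, E) be a connected directed graph with source s0 and sink sf, and let R : S* → [0, ∞) be a summable nonnegative reward. Then ℱ_R⁺ = ℱ⁺_{R,acyclic} + H¹₊(G): every nonnegative summable R-flow F decomposes as F = F_a + F_c with F_a a nonnegative acyclic R-flow and F_c ∈ H¹₊(G). In particular every nonnegative summable 0-flow on G lies in H¹₊(G), i.e. is of cyclic type. -/
open scoped Classical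

/-- A generalized `R`-flow on the directed graph `G = (S, E)`: a summable real function on
the edges (encoded as a function on `S × S` vanishing off `E`) satisfying flow matching at
every state of `S* = S \ {s0, sf}` and `F(s → sf) = R(s)` on terminal edges. -/
def IsGenRFlow {S : Type*} (E : Set (S × S)) (s0 sf : S) (R : S → ℝ) (F : S × S → ℝ) : Prop :=
  (∀ e, e ∉ E → F e = 0) ∧ Summable F ∧
  (∀ s : S, s ≠ s0 → s ≠ sf → ∑' s' : S, F (s', s) = ∑' s' : S, F (s, s')) ∧
  (∀ s : S, (s, sf) ∈ E → F (s, sf) = R s)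

/-- The (nonnegative) indicator flow `1_γ` of a simple directed cycle `γ` contained in
`S* = S \ {s0, sf}`, encoded by a `p`-periodic sequence of pairwise distinct states whose
consecutive pairs are edges of `E`. -/
def IsDirCycleFlow {S : Type*} (E : Set (S × S)) (s0 sf : S) (g : S × S → ℝ) : Prop :=
  ∃ (p : ℕ) (c : ℕ → S),
    1 ≤ p ∧ (∀ i, c (i + p) = c i) ∧
    (∀ i < p, ∀ j < p, c i = c j → i = j) ∧
    (∀ i, c i ≠ s0 ∧ c i ≠ sf) ∧
    (∀ i, (c i, c (i + 1)) ∈ E) ∧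
    g = fun e => if ∃ i < p, e = (c i, c (i + 1)) then (1 : ℝ) else 0

/-- Membership in `H¹₊(G)`: the `ℓ¹(E)`-closure of the set of finite nonnegative linear
combinations of indicators of simple directed cycles in `S*`. -/
def MemH1plus {S : Type*} (E : Set (S × S)) (s0 sf : S) (F : S × S → ℝ) : Prop :=
  Summable F ∧ ∀ ε : ℝ, 0 < ε →
    ∃ g ∈ AddSubmonoid.closure
        {g : S × S → ℝ | ∃ a : ℝ, 0 ≤ a ∧ ∃ g' : S × S → ℝ,
          IsDirCycleFlow E s0 sf g' ∧ g = a • g'},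
      ∑' e : S × S, |F e - g e| < ε

/-- A nonnegative flow is acyclic if there is no directed cycle in `S*` on all of whose
edges the flow is positive. -/
def IsAcyclicFlow {S : Type*} (s0 sf : S) (F : S × S → ℝ) : Prop :=
  ¬ ∃ (p : ℕ) (c : ℕ → S),
      1 ≤ p ∧ (∀ i, c (i + p) = c i) ∧
      (∀ i, c i ≠ s0 ∧ c i ≠ sf) ∧ (∀ i, 0 < F (c i, c (i + 1)))

/-- A nonnegative circulation on the edges `E`: summable, vanishing off `E` and on the edges
into `sf`, with flow matching at every state. -/
structure IsCirculation {S : Type*} (E : Set (S × S)) (sf : S) (g : S × S → ℝ) : Prop where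
  nonneg : ∀ e, 0 ≤ g e
  eq_zero : ∀ e, e ∉ E → g e = 0
  summable : Summable g
  matching : ∀ s : S, ∑' s' : S, g (s', s) = ∑' s' : S, g (s, s')
  sink : ∀ s : S, g (s, sf) = 0

/-- The finite nonnegative linear combinations of indicators of simple directed cycles. -/
def cycleCone {S : Type*} (E : Set (S × S)) (s0 sf : S) : AddSubmonoid (S × S → ℝ) :=
  AddSubmonoid.closure
    {g : S × S → ℝ | ∃ a : ℝ, 0 ≤ a ∧ ∃ g' : S × S → ℝ, IsDirCycleFlow E s0 sf g' ∧ g = a • g'}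

section Summability

variable {S : Type*} {F : S × S → ℝ}

theorem Summable.comp_prodMk_left (hF : Summable F) (s : S) : Summable fun s' => F (s, s') :=
  hF.comp_injective (i := fun s' => (s, s')) fun _ _ h => (Prod.mk.inj h).2

theorem Summable.comp_prodMk_right (hF : Summable F) (s : S) : Summable fun s' => F (s', s) :=
  hF.comp_injective (i := fun s' => (s', s)) fun _ _ h => (Prod.mk.inj h).1

theorem tsum_abs_comp_le {ι κ : Type*} {f : κ → ℝ} (hf : Summable f) {i : ι → κ}
    (hi : Function.Injective i) : |∑' x, f (i x)| ≤ ∑' y, |f y| := by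
  have h := hf.abs.comp_injective hi
  calc |∑' x, f (i x)| ≤ ∑' x, |f (i x)| := by
        simpa only [Real.norm_eq_abs] using norm_tsum_le_tsum_norm (f := fun x => f (i x)) h
    _ ≤ ∑' y, |f y| :=
        h.tsum_le_tsum_of_inj i hi (fun _ _ => abs_nonneg _) (fun _ => le_rfl) hf.abs

end Summability

section Circulations

variable {S : Type*} {E : Set (S × S)} {s0 sf : S}

theorem IsDirCycleFlow.isCirculation {g : S × S → ℝ} (hg : IsDirCycleFlow E s0 sf g) :
    IsCirculation E sf g := by
  obtain ⟨p, c, hp, hper, hinj, hne, hE, rfl⟩ := hg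
  have key : (fun e : S × S => if ∃ i < p, e = (c i, c (i + 1)) then (1 : ℝ) else 0) =
      fun e => ∑ i ∈ Finset.range p, if e = (c i, c (i + 1)) then (1 : ℝ) else 0 := by
    funext e
    split_ifs with h
    · obtain ⟨i, hi, rfl⟩ := h
      rw [Finset.sum_eq_single_of_mem i (Finset.mem_range.2 hi), if_pos rfl]
      intro j hj hji
      refine if_neg fun h => hji ?_
      exact (hinj i hi j (Finset.mem_range.1 hj) (Prod.mk.inj h).1).symm
    · refine (Finset.sum_eq_zero fun i hi => if_neg fun he => h ⟨i, Finset.mem_range.1 hi, he⟩).symm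
  refine ⟨fun e => ?_, fun e he => ?_, ?_, fun s => ?_, fun s => ?_⟩
  · split_ifs <;> norm_num
  · refine if_neg ?_
    rintro ⟨i, _, rfl⟩
    exact he (hE i)
  · rw [key]
    exact summable_sum fun i _ => (hasSum_ite_eq (c i, c (i + 1)) (1 : ℝ)).summable
  · have hin : ∀ i, HasSum (fun s' => if (s', s) = (c i, c (i + 1)) then (1 : ℝ) else 0)
        (if s = c (i + 1) then 1 else 0) := by
      intro i
      by_cases h : s = c (i + 1)
      · simpa [Prod.ext_iff, h] using hasSum_ite_eq (c i) (1 : ℝ)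
      · simp [h]
    have hout : ∀ i, HasSum (fun s' => if (s, s') = (c i, c (i + 1)) then (1 : ℝ) else 0)
        (if s = c i then 1 else 0) := by
      intro i
      by_cases h : s = c i
      · simpa [Prod.ext_iff, h] using hasSum_ite_eq (c (i + 1)) (1 : ℝ)
      · simp [h]
    have h0 : c p = c 0 := by simpa using hper 0
    have e1 := congrArg (fun (f : S × S → ℝ) => ∑' s', f (s', s)) key
    have e2 := congrArg (fun (f : S × S → ℝ) => ∑' s', f (s, s')) key
    rw [e1, e2, (hasSum_sum fun i _ => hin i).tsum_eq, (hasSum_sum fun i _ => hout i).tsum_eq]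
    have h1 := Finset.sum_range_succ (fun i => if s = c i then (1 : ℝ) else 0) p
    have h2 := Finset.sum_range_succ' (fun i => if s = c i then (1 : ℝ) else 0) p
    simp only [h0] at h1 h2
    linarith
  · refine if_neg ?_
    rintro ⟨i, _, h⟩
    exact (hne (i + 1)).2 (Prod.mk.inj h).2.symm

theorem IsCirculation.zero : IsCirculation E sf (0 : S × S → ℝ) :=
  ⟨fun _ => le_rfl, fun _ _ => rfl, summable_zero, fun _ => by simp, fun _ => rfl⟩

theorem IsCirculation.add {f g : S × S → ℝ} (hf : IsCirculation E sf f)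
    (hg : IsCirculation E sf g) : IsCirculation E sf (f + g) where
  nonneg e := add_nonneg (hf.nonneg e) (hg.nonneg e)
  eq_zero e he := by simp [hf.eq_zero e he, hg.eq_zero e he]
  summable := hf.summable.add hg.summable
  matching s := by
    simp only [Pi.add_apply]
    rw [(hf.summable.comp_prodMk_right s).tsum_add (hg.summable.comp_prodMk_right s),
      (hf.summable.comp_prodMk_left s).tsum_add (hg.summable.comp_prodMk_left s),
      hf.matching, hg.matching]
  sink s := by simp [hf.sink s, hg.sink s]

theorem IsCirculation.smul {f : S × S → ℝ} (hf : IsCirculation E sf f) {a : ℝ} (ha : 0 ≤ a) :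
    IsCirculation E sf (a • f) where
  nonneg e := mul_nonneg ha (hf.nonneg e)
  eq_zero e he := by simp [hf.eq_zero e he]
  summable := hf.summable.mul_left a
  matching s := by
    simp only [Pi.smul_apply, smul_eq_mul, tsum_mul_left, hf.matching]
  sink s := by simp [hf.sink s]

theorem isCirculation_of_mem_cycleCone {g : S × S → ℝ} (hg : g ∈ cycleCone E s0 sf) :
    IsCirculation E sf g := by
  induction hg using AddSubmonoid.closure_induction with
  | mem x hx =>
    obtain ⟨a, ha, g', hg', rfl⟩ := hx
    exact hg'.isCirculation.smul ha
  | zero => exact IsCirculation.zero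
  | add x y _ _ hx hy => exact hx.add hy

theorem MemH1plus.isCirculation {F : S × S → ℝ} (hF : MemH1plus E s0 sf F) :
    IsCirculation E sf F := by
  have approx : ∀ ε : ℝ, 0 < ε → ∃ g, IsCirculation E sf g ∧ ∑' e, |F e - g e| < ε := by
    intro ε hε
    obtain ⟨g, hg, h⟩ := hF.2 ε hε
    exact ⟨g, isCirculation_of_mem_cycleCone hg, h⟩
  have pointwise : ∀ g, IsCirculation E sf g → ∀ e, |F e - g e| ≤ ∑' e, |F e - g e| :=
    fun g hg e => (hF.1.sub hg.summable).abs.le_tsum e fun _ _ => abs_nonneg _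
  have vanish : ∀ e, (∀ g, IsCirculation E sf g → g e = 0) → F e = 0 := by
    intro e he
    refine abs_nonpos_iff.1 (le_of_forall_pos_le_add fun ε hε => ?_)
    obtain ⟨g, hg, h⟩ := approx ε hε
    have := pointwise g hg e
    rw [he g hg, sub_zero] at this
    linarith
  refine ⟨fun e => ?_, fun e he => vanish e fun g hg => hg.eq_zero e he, hF.1, fun s => ?_,
    fun s => vanish _ fun g hg => hg.sink s⟩
  · refine le_of_forall_pos_le_add fun ε hε => ?_
    obtain ⟨g, hg, h⟩ := approx ε hε
    have h1 := abs_le.1 (pointwise g hg e)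
    have h2 := hg.nonneg e
    linarith [h1.1]
  · rw [← sub_eq_zero]
    refine abs_nonpos_iff.1 (le_of_forall_pos_le_add fun ε hε => ?_)
    obtain ⟨g, hg, h⟩ := approx (ε / 2) (half_pos hε)
    have hd := hF.1.sub hg.summable
    have h1 := tsum_abs_comp_le hd (i := fun s' => (s', s)) fun _ _ h => (Prod.mk.inj h).1
    have h2 := tsum_abs_comp_le hd (i := fun s' => (s, s')) fun _ _ h => (Prod.mk.inj h).2
    rw [(hF.1.comp_prodMk_right s).tsum_sub (hg.summable.comp_prodMk_right s)] at h1
    rw [(hF.1.comp_prodMk_left s).tsum_sub (hg.summable.comp_prodMk_left s)] at h2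
    rw [hg.matching s] at h1
    rw [abs_le] at h1 h2 ⊢
    constructor <;> linarith [h1.1, h1.2, h2.1, h2.2]

end Circulations

section CycleRemoval

variable {S : Type*} {E : Set (S × S)} {s0 sf : S}

/-- Saturate the cycle with edge set `T` in a subflow `g` of `F`. -/
theorem exists_saturated_subflow {F g : S × S → ℝ} (hg : g ∈ cycleCone E s0 sf)
    (hgF : g ≤ F) (T : Finset (S × S)) :
    ∃ g' ∈ cycleCone E s0 sf, g' ≤ F ∧ g ≤ g' ∧
      (IsDirCycleFlow E s0 sf (fun e => if e ∈ T then 1 else 0) → ∃ e ∈ T, g' e = F e) := by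
  by_cases hT : IsDirCycleFlow E s0 sf (fun e => if e ∈ T then 1 else 0)
  swap
  · exact ⟨g, hg, hgF, le_rfl, fun h => (hT h).elim⟩
  have hne : T.Nonempty := by
    obtain ⟨p, c, hp, -, -, -, -, h⟩ := hT
    refine ⟨(c 0, c 1), ?_⟩
    have := congrFun h (c 0, c 1)
    rw [if_pos (⟨0, hp, rfl⟩ : ∃ i < p, (c 0, c 1) = (c i, c (i + 1)))] at this
    by_contra hc
    simp [hc] at this
  obtain ⟨e₀, he₀, hmin⟩ := T.exists_min_image (fun e => F e - g e) hne
  have ha : 0 ≤ F e₀ - g e₀ := sub_nonneg.2 (hgF e₀)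
  refine ⟨g + (F e₀ - g e₀) • (fun e => if e ∈ T then 1 else 0), add_mem hg
    (AddSubmonoid.subset_closure ⟨_, ha, _, hT, rfl⟩), fun e => ?_, fun e => ?_,
    fun _ => ⟨e₀, he₀, ?_⟩⟩
  · simp only [Pi.add_apply, Pi.smul_apply, smul_eq_mul]
    split_ifs with h
    · linarith [hmin e h]
    · simpa using hgF e
  · simp only [Pi.add_apply, Pi.smul_apply, smul_eq_mul]
    split_ifs <;> linarith
  · simp [he₀]

theorem exists_maximal_cyclic_subflow [Countable S] {F : S × S → ℝ} (hF : Summable F)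
    (hF0 : 0 ≤ F) :
    ∃ Fc, MemH1plus E s0 sf Fc ∧ Fc ≤ F ∧ ∀ T : Finset (S × S),
      IsDirCycleFlow E s0 sf (fun e => if e ∈ T then 1 else 0) → ∃ e ∈ T, Fc e = F e := by
  obtain ⟨T, hT⟩ := exists_surjective_nat (Finset (S × S))
  choose! next hmem hle hmono hsat using
    fun (g : S × S → ℝ) (h : g ∈ cycleCone E s0 sf ∧ g ≤ F) =>
      exists_saturated_subflow h.1 h.2
  let G : ℕ → S × S → ℝ := fun n => Nat.rec 0 (fun k g => next g (T k)) n
  have hG : ∀ n, G n ∈ cycleCone E s0 sf ∧ G n ≤ F := by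
    intro n
    induction n with
    | zero => exact ⟨zero_mem _, hF0⟩
    | succ n ih => exact ⟨hmem _ ih _, hle _ ih _⟩
  have hGmono : Monotone G := monotone_nat_of_le_succ fun n => hmono _ (hG n) _
  have hG0 : ∀ n e, 0 ≤ G n e := fun n e => hGmono (Nat.zero_le n) e
  have hbdd : ∀ e, BddAbove (Set.range fun n => G n e) := fun e =>
    ⟨F e, by rintro _ ⟨n, rfl⟩; exact (hG n).2 e⟩
  have hlim : ∀ e, Filter.Tendsto (fun n => G n e) Filter.atTop (nhds (⨆ n, G n e)) :=
    fun e => tendsto_atTop_ciSup (fun _ _ h => hGmono h e) (hbdd e)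
  have hle_sup : ∀ n e, G n e ≤ ⨆ n, G n e := fun n e => le_ciSup (hbdd e) n
  have hsup_le : ∀ e, ⨆ n, G n e ≤ F e := fun e => ciSup_le fun n => (hG n).2 e
  refine ⟨fun e => ⨆ n, G n e, ⟨?_, fun ε hε => ?_⟩, hsup_le, fun A hA => ?_⟩
  · exact hF.of_nonneg_of_le (fun e => (hG0 0 e).trans (hle_sup 0 e)) hsup_le
  · have htend : Filter.Tendsto (fun n => ∑' e, |(⨆ n, G n e) - G n e|) Filter.atTop
        (nhds (∑' _ : S × S, (0 : ℝ))) := by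
      refine tendsto_tsum_of_dominated_convergence hF (fun e => ?_)
        (Filter.Eventually.of_forall fun n e => ?_)
      · simpa using ((hlim e).const_sub (⨆ n, G n e)).abs
      · rw [Real.norm_eq_abs, abs_abs, abs_of_nonneg (sub_nonneg.2 (hle_sup n e))]
        linarith [hsup_le e, hG0 n e]
    rw [tsum_zero] at htend
    obtain ⟨n, hn⟩ := (htend.eventually_lt_const hε).exists
    exact ⟨G n, (hG n).1, hn⟩
  · obtain ⟨n, rfl⟩ := hT A
    obtain ⟨e, he, heq⟩ := hsat (G n) (hG n) (T n) hA
    refine ⟨e, he, le_antisymm (hsup_le e) ?_⟩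
    rw [← heq]
    exact hle_sup (n + 1) e

end CycleRemoval

section Cycles

variable {S : Type*}

theorem exists_periodic_of_closed_path {P : S → S → Prop} {d : ℕ} (hd : 1 ≤ d) {f : ℕ → S}
    (hf : f d = f 0) (hP : ∀ i < d, P (f i) (f (i + 1))) (k : ℕ) :
    P (f (k % d)) (f ((k + 1) % d)) := by
  have hk : k % d < d := Nat.mod_lt _ hd
  rcases Nat.lt_or_ge (k % d + 1) d with h | h
  · have : (k + 1) % d = k % d + 1 := by
      rw [← Nat.mod_add_mod, Nat.mod_eq_of_lt h]
    rw [this]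
    exact hP _ hk
  · have h' : k % d + 1 = d := by omega
    have : (k + 1) % d = 0 := by
      rw [← Nat.mod_add_mod, h', Nat.mod_self]
    rw [this, ← hf]
    conv_rhs => rw [← h']
    exact hP _ hk

/-- A directed cycle contains a simple one. -/
theorem exists_simple_cycle {P : S → S → Prop} {Q : S → Prop}
    (h : ∃ (p : ℕ) (c : ℕ → S), 1 ≤ p ∧ (∀ i, c (i + p) = c i) ∧ (∀ i, Q (c i)) ∧
      ∀ i, P (c i) (c (i + 1))) :
    ∃ (p : ℕ) (c : ℕ → S), 1 ≤ p ∧ (∀ i, c (i + p) = c i) ∧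
      (∀ i < p, ∀ j < p, c i = c j → i = j) ∧ (∀ i, Q (c i)) ∧ ∀ i, P (c i) (c (i + 1)) := by
  obtain ⟨c, hp, hper, hQ, hP⟩ := Nat.find_spec h
  have hmin := fun m => @Nat.find_min _ _ h m
  refine ⟨Nat.find h, c, hp, hper, ?_, hQ, hP⟩
  have aux : ∀ i j, i < j → j < Nat.find h → c i ≠ c j := by
    intro i j hij hj hc
    refine hmin (j - i) (by omega) ⟨fun k => c (i + k % (j - i)), by omega, fun k => by simp,
      fun k => hQ _, ?_⟩
    refine exists_periodic_of_closed_path (f := fun k => c (i + k)) (by omega) ?_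
      fun k _ => hP (i + k)
    simp [Nat.add_sub_cancel' hij.le, hc]
  intro i hi j hj hc
  rcases lt_trichotomy i j with hij | hij | hij
  · exact (aux i j hij hj hc).elim
  · exact hij
  · exact (aux j i hij hi hc.symm).elim

theorem Relation.ReflTransGen.exists_path {P : S → S → Prop} {a b : S}
    (h : Relation.ReflTransGen P a b) :
    ∃ (n : ℕ) (f : ℕ → S), f 0 = a ∧ f n = b ∧ ∀ i < n, P (f i) (f (i + 1)) := by
  induction h with
  | refl => exact ⟨0, fun _ => a, rfl, rfl, by simp⟩
  | @tail b d _ hbd ih =>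
    obtain ⟨n, f, h0, hn, hf⟩ := ih
    refine ⟨n + 1, fun i => if i ≤ n then f i else d, by simpa using h0, by simp, fun i hi => ?_⟩
    rcases Nat.lt_succ_iff_lt_or_eq.1 hi with h | rfl
    · simpa [h.le, Nat.succ_le_of_lt h] using hf i h
    · simpa [hn] using hbd

theorem exists_periodic_of_reachable {P : S → S → Prop} {u v : S} (huv : P u v)
    (h : Relation.ReflTransGen P v u) :
    ∃ (p : ℕ) (c : ℕ → S), 1 ≤ p ∧ (∀ i, c (i + p) = c i) ∧ ∀ i, P (c i) (c (i + 1)) := by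
  obtain ⟨n, f, h0, hn, hf⟩ := h.exists_path
  refine ⟨n + 1, fun k => (fun i => if i ≤ n then f i else v) (k % (n + 1)), by omega,
    fun i => by simp, exists_periodic_of_closed_path (by omega) (by simp [h0]) fun i hi => ?_⟩
  rcases Nat.lt_succ_iff_lt_or_eq.1 hi with h | rfl
  · simpa [h.le, Nat.succ_le_of_lt h] using hf i h
  · simpa [hn] using huv

end Cycles

section AcyclicFlows

variable {S : Type*} {E : Set (S × S)} {s0 sf : S}

/-- A set left by no flow and at whose states flow matching holds is entered by no flow. -/
theorem mem_of_flow_pos_of_closed {F : S × S → ℝ} (hF : Summable F) (hF0 : ∀ e, 0 ≤ F e)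
    {A : Set S} (hA : ∀ s ∈ A, ∑' s', F (s', s) = ∑' s', F (s, s'))
    (hclosed : ∀ s ∈ A, ∀ s', 0 < F (s, s') → s' ∈ A) {u v : S} (hv : v ∈ A)
    (huv : 0 < F (u, v)) : u ∈ A := by
  by_contra hu
  let out : S × S → ℝ := {e | e.1 ∈ A}.indicator F
  let inn : S × S → ℝ := {e | e.2 ∈ A}.indicator F
  have hout : Summable out := hF.indicator _
  have hinn : Summable inn := hF.indicator _
  have hle : out ≤ inn := by
    intro e
    simp only [out, inn, Set.indicator, Set.mem_ofPred_eq]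
    split_ifs with h1 h2 h2
    · exact le_rfl
    · exact le_of_not_gt fun h => h2 (hclosed e.1 h1 e.2 h)
    · exact hF0 e
    · exact le_rfl
  have hlt : out (u, v) < inn (u, v) := by simp [out, inn, hu, hv, huv]
  have heq : ∑' e, out e = ∑' e, inn e := by
    rw [hout.tsum_prod, hinn.tsum_prod,
      ← Summable.tsum_comm (f := fun a b => inn (a, b)) hinn]
    refine tsum_congr fun s => ?_
    by_cases hs : s ∈ A
    · simpa [out, inn, hs] using (hA s hs).symm
    · simp [out, inn, hs]
  exact (Summable.tsum_lt_tsum hle hlt hout hinn).ne heq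

theorem IsAcyclicFlow.eq_zero_of_zero_reward (hsrc : ∀ s : S, (s, s0) ∉ E)
    (hsnk : ∀ s : S, (sf, s) ∉ E) {F : S × S → ℝ} (hF : IsGenRFlow E s0 sf (fun _ => 0) F)
    (hF0 : ∀ e, 0 ≤ F e) (hac : IsAcyclicFlow s0 sf F) : F = 0 := by
  obtain ⟨hE, hsum, hmatch, hsink⟩ := hF
  have hpos : ∀ e, 0 < F e → e ∈ E := fun e h => by_contra fun he => h.ne' (hE e he)
  have hterm : ∀ a b, 0 < F (a, b) → b ≠ s0 ∧ b ≠ sf := by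
    refine fun a b h => ⟨?_, ?_⟩
    · rintro rfl
      exact hsrc a (hpos _ h)
    · rintro rfl
      exact h.ne' (hsink a (hpos _ h))
  funext ⟨u, v⟩
  by_contra huv
  replace huv : 0 < F (u, v) := lt_of_le_of_ne (hF0 _) (Ne.symm huv)
  let P : S → S → Prop := fun a b => 0 < F (a, b)
  have hA : ∀ s, Relation.ReflTransGen P v s → s ≠ s0 ∧ s ≠ sf := by
    intro s hs
    rcases hs.cases_tail with rfl | ⟨w, _, hw⟩
    · exact hterm u _ huv
    · exact hterm w s hw
  have hu : u ∈ {s | Relation.ReflTransGen P v s} :=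
    mem_of_flow_pos_of_closed hsum hF0
      (fun s hs => hmatch s (hA s hs).1 (hA s hs).2) (fun s hs s' h => hs.tail h)
      Relation.ReflTransGen.refl huv
  obtain ⟨p, c, hp, hper, hP⟩ := exists_periodic_of_reachable (P := P) huv hu
  refine hac ⟨p, c, hp, hper, fun i => ?_, hP⟩
  have h := hterm _ _ (hP (i + (p - 1)))
  rwa [show i + (p - 1) + 1 = i + p by omega, hper] at h

end AcyclicFlows

section Decomposition

variable {S : Type*} {E : Set (S × S)} {s0 sf : S} {R : S → ℝ}

theorem IsGenRFlow.add_circulation {F g : S × S → ℝ} (hF : IsGenRFlow E s0 sf R F)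
    (hg : IsCirculation E sf g) : IsGenRFlow E s0 sf R (F + g) := by
  obtain ⟨hE, hsum, hmatch, hsink⟩ := hF
  refine ⟨fun e he => by simp [hE e he, hg.eq_zero e he], hsum.add hg.summable,
    fun s h0 hf => ?_, fun s hs => by simp [hsink s hs, hg.sink s]⟩
  simp only [Pi.add_apply]
  rw [(hsum.comp_prodMk_right s).tsum_add (hg.summable.comp_prodMk_right s),
    (hsum.comp_prodMk_left s).tsum_add (hg.summable.comp_prodMk_left s),
    hmatch s h0 hf, hg.matching]

theorem IsGenRFlow.sub_circulation {F g : S × S → ℝ} (hF : IsGenRFlow E s0 sf R F)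
    (hg : IsCirculation E sf g) : IsGenRFlow E s0 sf R (F - g) := by
  obtain ⟨hE, hsum, hmatch, hsink⟩ := hF
  refine ⟨fun e he => by simp [hE e he, hg.eq_zero e he], hsum.sub hg.summable,
    fun s h0 hf => ?_, fun s hs => by simp [hsink s hs, hg.sink s]⟩
  simp only [Pi.sub_apply]
  rw [(hsum.comp_prodMk_right s).tsum_sub (hg.summable.comp_prodMk_right s),
    (hsum.comp_prodMk_left s).tsum_sub (hg.summable.comp_prodMk_left s),
    hmatch s h0 hf, hg.matching]

theorem IsGenRFlow.exists_acyclic_add_cyclic [Countable S] {F : S × S → ℝ}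
    (hF : IsGenRFlow E s0 sf R F) (hF0 : ∀ e, 0 ≤ F e) :
    ∃ Fa Fc : S × S → ℝ, F = Fa + Fc ∧ IsGenRFlow E s0 sf R Fa ∧ (∀ e, 0 ≤ Fa e) ∧
      IsAcyclicFlow s0 sf Fa ∧ MemH1plus E s0 sf Fc := by
  obtain ⟨Fc, hFc, hle, hsat⟩ := exists_maximal_cyclic_subflow (E := E) (s0 := s0) (sf := sf)
    hF.2.1 hF0
  refine ⟨F - Fc, Fc, (sub_add_cancel F Fc).symm, hF.sub_circulation hFc.isCirculation,
    fun e => sub_nonneg.2 (hle e), fun hcyc => ?_, hFc⟩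
  obtain ⟨p, c, hp, hper, hinj, hne, hpos⟩ := exists_simple_cycle
    (P := fun a b => 0 < (F - Fc) (a, b)) (Q := fun s => s ≠ s0 ∧ s ≠ sf) hcyc
  have hcE : ∀ i, (c i, c (i + 1)) ∈ E := by
    intro i
    by_contra h
    have h1 := hpos i
    simp [hF.1 _ h, hFc.isCirculation.eq_zero _ h] at h1
  obtain ⟨e, he, heq⟩ := hsat ((Finset.range p).image fun i => (c i, c (i + 1)))
    ⟨p, c, hp, hper, hinj, hne, hcE, by
      funext e
      simp only [Finset.mem_image, Finset.mem_range, eq_comm (a := e)]⟩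
  obtain ⟨i, _, rfl⟩ := Finset.mem_image.1 he
  have h1 := hpos i
  simp [heq] at h1

end Decomposition

/-- For a connected directed graph `G = (S, E)` with source `s0`, sink `sf`
and summable nonnegative reward `R`: `ℱ_R⁺ = ℱ⁺_{R,acyclic} + H¹₊(G)`, i.e. the nonnegative
summable `R`-flows are exactly the sums of a nonnegative acyclic `R`-flow and an element of
`H¹₊(G)`; in particular every nonnegative summable `0`-flow on `G` lies in `H¹₊(G)`,
i.e. is of cyclic type. -/
theorem nonneg_RFlow_decomposition
    {S : Type*} [Countable S] (E : Set (S × S)) (s0 sf : S) (hne : s0 ≠ sf)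
    (hsrc : ∀ s : S, (s, s0) ∉ E) (hsnk : ∀ s : S, (sf, s) ∉ E)
    (hconn : ∀ s : S, ∃ (n : ℕ) (p : ℕ → S), p 0 = s0 ∧ p n = sf ∧ (∃ k ≤ n, p k = s) ∧
      ∀ i < n, (p i, p (i + 1)) ∈ E)
    (R : S → ℝ) (hR_nonneg : ∀ s : S, 0 ≤ R s) (hR_sum : Summable R) :
    -- `ℱ_R⁺ = ℱ⁺_{R,acyclic} + H¹₊(G)`
    (∀ F : S × S → ℝ,
      (IsGenRFlow E s0 sf R F ∧ ∀ e, 0 ≤ F e) ↔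
      (∃ Fa Fc : S × S → ℝ, F = Fa + Fc ∧
        IsGenRFlow E s0 sf R Fa ∧ (∀ e, 0 ≤ Fa e) ∧ IsAcyclicFlow s0 sf Fa ∧
        MemH1plus E s0 sf Fc)) ∧
    -- every nonnegative summable `0`-flow lies in `H¹₊(G)`
    (∀ F : S × S → ℝ, IsGenRFlow E s0 sf (fun _ => 0) F → (∀ e, 0 ≤ F e) →
      MemH1plus E s0 sf F) := by
  refine ⟨fun F => ⟨fun h => h.1.exists_acyclic_add_cyclic h.2, ?_⟩, fun F hF hF0 => ?_⟩
  · rintro ⟨Fa, Fc, rfl, hFa, hFa0, -, hFc⟩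
    exact ⟨hFa.add_circulation hFc.isCirculation,
      fun e => add_nonneg (hFa0 e) (hFc.isCirculation.nonneg e)⟩
  · obtain ⟨Fa, Fc, rfl, hFa, hFa0, hac, hFc⟩ := hF.exists_acyclic_add_cyclic hF0
    rw [hac.eq_zero_of_zero_reward hsrc hsnk hFa hFa0, zero_add]
    exact hFc
end

section
/- Let (X, 𝒜, F1) be a finite measure space, α : X → (0, ∞) a bounded measurable function, β : X → [0, 1] measurable, and f : (0, ∞) → ℝ convex and continuous with f ≥ 0 and f(1) = 0; assume x ↦ f((α(x) + tβ(x))/(1 + tβ(x)))·(1 + tβ(x)) is F1-integrable for each t ≥ 0. Then the function φ(t) := ∫_X f((α + tβ)/(1 + tβ))·(1 + tβ) dF1 is non-increasing on [0, ∞); indeed for each x the integrand is non-increasing in t. (Interpretation: with F2 := α·F1 and the 0-flow direction F0 := β·F1 ≤ F1, the directional derivative of the f-divergence div_f(F2, F1) = ∫ f(dF2/dF1) dF1 along (F0, F0) is nonpositive, i.e. divergence-based flow-matching and detailed-balance losses are unstable.) -/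
open MeasureTheory

/-- If `f` is convex on `(0, ∞)` and vanishes at `1`, then `u ↦ (1 + u) f ((a + u) / (1 + u))` is
non-increasing on `[0, ∞)`: adding mass to both measures moves their ratio towards `1`. -/
lemma ConvexOn.antitoneOn_perspective_add {f : ℝ → ℝ} (hf : ConvexOn ℝ (Set.Ioi (0 : ℝ)) f)
    (hf1 : f 1 = 0) {a : ℝ} (ha : 0 < a) :
    AntitoneOn (fun u : ℝ => f ((a + u) / (1 + u)) * (1 + u)) (Set.Ici 0) := by
  intro u hu v _ huv
  have hu : 0 ≤ u := hu
  have hp : 0 < 1 + u := by linarith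
  have hq : 0 < 1 + v := by linarith
  have hx : (a + u) / (1 + u) ∈ Set.Ioi (0 : ℝ) := div_pos (by linarith) hp
  have key := hf.2 hx (Set.mem_Ioi.2 one_pos) (div_pos hp hq).le
    (div_nonneg (sub_nonneg.2 huv) hq.le) (by field_simp; ring)
  have hcomb : ((1 + u) / (1 + v)) • ((a + u) / (1 + u)) + ((v - u) / (1 + v)) • (1 : ℝ)
      = (a + v) / (1 + v) := by
    simp only [smul_eq_mul]
    field_simp
    ring
  rw [hcomb, hf1, smul_zero, add_zero, smul_eq_mul, div_mul_eq_mul_div, le_div_iff₀ hq] at key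
  simpa only [mul_comm] using key

/-- Let `(X, 𝒜, F1)` be a finite measure space, `α : X → (0, ∞)` bounded
measurable, `β : X → [0, 1]` measurable, and `f : (0, ∞) → ℝ` convex continuous with `f ≥ 0`
and `f 1 = 0`; assume the integrand is `F1`-integrable for each `t ≥ 0`. Then
`φ(t) := ∫ f((α + tβ)/(1 + tβ)) (1 + tβ) dF1` is non-increasing on `[0, ∞)`; indeed for each
`x` the integrand is non-increasing in `t`. (This is the instability of divergence-based
flow-matching and detailed-balance losses in the direction of a `0`-flow `F0 = β F1 ≤ F1`,
with `F2 = α F1`.) -/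
theorem divergence_loss_unstable
    {X : Type*} [MeasurableSpace X] (F1 : Measure X) [IsFiniteMeasure F1]
    (α β : X → ℝ) (hαm : Measurable α) (hβm : Measurable β)
    (hαpos : ∀ x, 0 < α x) (hαbdd : ∃ C : ℝ, ∀ x, α x ≤ C)
    (hβ : ∀ x, β x ∈ Set.Icc (0 : ℝ) 1)
    (f : ℝ → ℝ)
    (hconv : ConvexOn ℝ (Set.Ioi (0 : ℝ)) f)
    (hcont : ContinuousOn f (Set.Ioi (0 : ℝ)))
    (hf_nonneg : ∀ x ∈ Set.Ioi (0 : ℝ), 0 ≤ f x) (hf1 : f 1 = 0)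
    (hint : ∀ t : ℝ, 0 ≤ t →
      Integrable (fun x => f ((α x + t * β x) / (1 + t * β x)) * (1 + t * β x)) F1) :
    -- each integrand is non-increasing in `t` on `[0, ∞)`
    (∀ x, AntitoneOn
      (fun t : ℝ => f ((α x + t * β x) / (1 + t * β x)) * (1 + t * β x)) (Set.Ici 0)) ∧
    -- hence `φ` is non-increasing on `[0, ∞)`
    AntitoneOn
      (fun t : ℝ => ∫ x, f ((α x + t * β x) / (1 + t * β x)) * (1 + t * β x) ∂F1)
      (Set.Ici 0) := by
  have anti : ∀ x, AntitoneOn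
      (fun t : ℝ => f ((α x + t * β x) / (1 + t * β x)) * (1 + t * β x)) (Set.Ici 0) :=
    fun x s hs t ht hst =>
      hconv.antitoneOn_perspective_add hf1 (hαpos x)
        (mul_nonneg hs (hβ x).1) (mul_nonneg ht (hβ x).1)
        (mul_le_mul_of_nonneg_right hst (hβ x).1)
  exact ⟨anti, fun s hs t ht hst =>
    integral_mono (hint t ht) (hint s hs) fun x => anti x hs ht hst⟩
end

section
/- Let f : (0, ∞) → [0, ∞) be continuous and piecewise continuously differentiable with f(x) = 0 if and only if x = 1. If f(x) − (x − 1)·f′(x) = 0 at every point x where f is differentiable, then there exist constants a, b > 0 such that f(x) = a·(x − 1) for all x ≥ 1 and f(x) = b·(1 − x) for all x ≤ 1; equivalently f(x) = ω₁·|1 − x| + ω₂·(1 − x) for some constants ω₁, ω₂, so the associated f-divergence is proportional to the total variation distance. -/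
/-- A locally finite subset of `ℝ` is countable. -/
theorem countable_of_locally_finite {D : Set ℝ}
    (hD : ∀ x : ℝ, ∃ U ∈ nhds x, (U ∩ D).Finite) : D.Countable := by
  choose U hU hfin using hD
  obtain ⟨s, hs, hcover⟩ := TopologicalSpace.countable_cover_nhds hU
  refine (hs.biUnion fun x _ => (hfin x).countable).mono fun y hy => ?_
  have hy' : y ∈ ⋃ x ∈ s, U x := hcover ▸ Set.mem_univ y
  simp only [Set.mem_iUnion] at hy' ⊢
  obtain ⟨x, hx, hyx⟩ := hy'
  exact ⟨x, hx, hyx, hy⟩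

/-- On an interval avoiding `c`, a continuous solution of `f x = (x - c) * f' x` outside a
countable set has `f x / (x - c)` constant. -/
theorem div_sub_eq_of_ode_off_countable {f : ℝ → ℝ} {D : Set ℝ} {c x y : ℝ} (hD : D.Countable)
    (hc : c ∉ Set.uIcc x y) (hcont : ContinuousOn f (Set.uIcc x y))
    (hdiff : ∀ z ∈ Set.uIcc x y \ D, DifferentiableAt ℝ f z)
    (hode : ∀ z ∈ Set.uIcc x y \ D, f z - (z - c) * deriv f z = 0) :
    f x / (x - c) = f y / (y - c) := by
  have hne : ∀ z ∈ Set.uIcc x y, z - c ≠ 0 := fun z hz h =>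
    hc (sub_eq_zero.mp h ▸ hz)
  have h := MeasureTheory.integral_eq_of_hasDerivAt_off_countable
    (fun z => f z / (z - c)) (fun _ => (0 : ℝ)) hD
    (hcont.div (by fun_prop) hne) (fun z hz => ?_) (by simp)
  · simp only [intervalIntegral.integral_zero] at h
    exact (sub_eq_zero.mp h.symm).symm
  · have hz' : z ∈ Set.uIcc x y \ D := ⟨Set.Ioo_subset_Icc_self hz.1, hz.2⟩
    have hd : HasDerivAt (fun z => f z / (z - c))
        ((deriv f z * (z - c) - f z * 1) / (z - c) ^ 2) z :=
      (hdiff z hz').hasDerivAt.div ((hasDerivAt_id z).sub_const c) (hne z hz'.1)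
    have hnum : deriv f z * (z - c) - f z * 1 = 0 := by linarith [hode z hz']
    rwa [hnum, zero_div] at hd

/-- Let `f : (0, ∞) → [0, ∞)` be continuous and piecewise continuously
differentiable (continuously differentiable outside a locally finite set `D`), with
`f x = 0 ↔ x = 1`. If `f(x) − (x − 1) f′(x) = 0` at every point where `f` is differentiable,
then there are constants `a, b > 0` with `f x = a (x − 1)` for `x ≥ 1` and `f x = b (1 − x)`
for `0 < x ≤ 1`; equivalently `f = ω₁ |1 − x| + ω₂ (1 − x)`, so the associated `f`-divergence
is proportional to the total variation distance. -/
theorem ode_characterizes_total_variation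
    (f : ℝ → ℝ) (D : Set ℝ)
    (hcont : ContinuousOn f (Set.Ioi (0 : ℝ)))
    (hf_nonneg : ∀ x ∈ Set.Ioi (0 : ℝ), 0 ≤ f x)
    (hf_zero : ∀ x ∈ Set.Ioi (0 : ℝ), (f x = 0 ↔ x = 1))
    -- `D` is locally finite
    (hD : ∀ x : ℝ, ∃ U ∈ nhds x, (U ∩ D).Finite)
    -- `f` is continuously differentiable outside `D`
    (hpw : ∀ x ∈ Set.Ioi (0 : ℝ) \ D,
      DifferentiableAt ℝ f x ∧ ContinuousAt (deriv f) x)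
    -- `f(x) − (x − 1) f′(x) = 0` wherever `f` is differentiable
    (hode : ∀ x ∈ Set.Ioi (0 : ℝ), DifferentiableAt ℝ f x →
      f x - (x - 1) * deriv f x = 0) :
    ∃ a b : ℝ, 0 < a ∧ 0 < b ∧
      (∀ x : ℝ, 1 ≤ x → f x = a * (x - 1)) ∧
      (∀ x : ℝ, 0 < x → x ≤ 1 → f x = b * (1 - x)) := by
  have hDc := countable_of_locally_finite hD
  have key : ∀ x y : ℝ, Set.uIcc x y ⊆ Set.Ioi 0 → (1 : ℝ) ∉ Set.uIcc x y →
      f x / (x - 1) = f y / (y - 1) := fun x y hpos hone =>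
    div_sub_eq_of_ode_off_countable hDc hone (hcont.mono hpos)
      (fun z hz => (hpw z ⟨hpos hz.1, hz.2⟩).1)
      (fun z hz => hode z (hpos hz.1) (hpw z ⟨hpos hz.1, hz.2⟩).1)
  have hf_pos : ∀ x : ℝ, 0 < x → x ≠ 1 → 0 < f x := fun x hx hne =>
    (hf_nonneg x hx).lt_of_ne fun h => hne ((hf_zero x hx).mp h.symm)
  have hf_one : f 1 = 0 := (hf_zero 1 (Set.mem_Ioi.mpr one_pos)).mpr rfl
  refine ⟨f 2, 2 * f (1 / 2), hf_pos 2 (by norm_num) (by norm_num),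
    mul_pos two_pos (hf_pos _ (by norm_num) (by norm_num)), fun x hx => ?_, fun x hx0 hx => ?_⟩
  · rcases hx.eq_or_lt with rfl | hx
    · simp [hf_one]
    have hlt : (1 : ℝ) < x ⊓ 2 := lt_inf_iff.mpr ⟨hx, one_lt_two⟩
    have h := key x 2 (fun z hz => one_pos.trans (hlt.trans_le hz.1))
      (fun h => hlt.not_ge h.1)
    rw [div_eq_iff (sub_pos.mpr hx).ne'] at h
    rw [h]
    ring
  · rcases hx.eq_or_lt with rfl | hx
    · simp [hf_one]
    have hpos : (0 : ℝ) < x ⊓ (1 / 2) := lt_inf_iff.mpr ⟨hx0, by norm_num⟩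
    have hlt : x ⊔ (1 / 2) < 1 := sup_lt_iff.mpr ⟨hx, by norm_num⟩
    have h := key x (1 / 2) (fun z hz => hpos.trans_le hz.1) (fun h => hlt.not_ge h.2)
    rw [div_eq_iff (sub_neg.mpr hx).ne] at h
    rw [h]
    ring
end

section
/- Let g : (0, ∞) → [0, ∞) be continuous and piecewise continuously differentiable with g(1) = 0. If (x − 1)·g′(x) ≤ 0 at every point x where g is differentiable (i.e. g is non-decreasing on (0, 1) and non-increasing on (1, ∞)), then g is identically zero. Consequently, for every such nonzero g vanishing only at 1 there exists a point x where (x − 1)·g′(x) > 0; this yields the instability of the losses of the form div_{g,ν}(F2, F1) = ∫ g(dF2/dF1) dν, since one can choose a density making the directional derivative along a 0-flow strictly negative. -/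
/-- A continuous function on `[a, b]` whose derivative exists and is nonnegative on `(a, b)` outside
a finite set satisfies `f a ≤ f b`. -/
theorem le_of_deriv_nonneg_off_finite {f : ℝ → ℝ} {S : Set ℝ} (hS : S.Finite) :
    ∀ {a b : ℝ}, a ≤ b → ContinuousOn f (Set.Icc a b) →
      (∀ x ∈ Set.Ioo a b \ S, DifferentiableAt ℝ f x ∧ 0 ≤ deriv f x) → f a ≤ f b := by
  induction S, hS using Set.Finite.induction_on with
  | empty =>
    intro a b hab hf hd
    refine monotoneOn_of_deriv_nonneg (convex_Icc a b) hf ?_ ?_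
      (Set.left_mem_Icc.2 hab) (Set.right_mem_Icc.2 hab) hab
    · rw [interior_Icc]
      exact fun x hx => (hd x ⟨hx, id⟩).1.differentiableWithinAt
    · rw [interior_Icc]
      exact fun x hx => (hd x ⟨hx, id⟩).2
  | @insert c S _ _ ih =>
    intro a b hab hf hd
    by_cases hc : c ∈ Set.Ioo a b
    · refine (ih hc.1.le (hf.mono (Set.Icc_subset_Icc_right hc.2.le)) ?_).trans
        (ih hc.2.le (hf.mono (Set.Icc_subset_Icc_left hc.1.le)) ?_)
      · rintro x ⟨hx, hxS⟩
        refine hd x ⟨⟨hx.1, hx.2.trans hc.2⟩, ?_⟩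
        rintro (h | h)
        exacts [hx.2.ne h, hxS h]
      · rintro x ⟨hx, hxS⟩
        refine hd x ⟨⟨hc.1.trans hx.1, hx.2⟩, ?_⟩
        rintro (h | h)
        exacts [hx.1.ne' h, hxS h]
    · refine ih hab hf ?_
      rintro x ⟨hx, hxS⟩
      refine hd x ⟨hx, ?_⟩
      rintro (h | h)
      exacts [hc (h ▸ hx), hxS h]

/-- A locally finite set meets every compact set in a finite set. -/
theorem IsCompact.finite_inter_of_locally_finite {X : Type*} [TopologicalSpace X] {K D : Set X}
    (hK : IsCompact K) (hD : ∀ x, ∃ U ∈ nhds x, (U ∩ D).Finite) : (K ∩ D).Finite := by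
  choose U hU hUD using hD
  obtain ⟨t, -, ht⟩ := hK.elim_nhds_subcover U fun x _ => hU x
  refine (t.finite_toSet.biUnion fun x _ => hUD x).subset ?_
  rintro x ⟨hxK, hxD⟩
  obtain ⟨y, hy, hxy⟩ := Set.mem_iUnion₂.1 (ht hxK)
  exact Set.mem_biUnion hy ⟨hxy, hxD⟩

/-- A nonnegative continuous function on `(0, ∞)` vanishing at `1`, differentiable outside a locally
finite set, and with `(x - 1) * g' x ≤ 0`, is identically zero. -/
theorem eq_zero_of_sub_one_mul_deriv_nonpos {g : ℝ → ℝ} {D : Set ℝ}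
    (hcont : ContinuousOn g (Set.Ioi (0 : ℝ))) (hg_nonneg : ∀ x ∈ Set.Ioi (0 : ℝ), 0 ≤ g x)
    (hg1 : g 1 = 0) (hD : ∀ x : ℝ, ∃ U ∈ nhds x, (U ∩ D).Finite)
    (hdiff : ∀ x ∈ Set.Ioi (0 : ℝ) \ D, DifferentiableAt ℝ g x)
    (hderiv : ∀ x ∈ Set.Ioi (0 : ℝ), DifferentiableAt ℝ g x → (x - 1) * deriv g x ≤ 0) :
    ∀ x ∈ Set.Ioi (0 : ℝ), g x = 0 := by
  intro x hx
  refine le_antisymm ?_ (hg_nonneg x hx)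
  rcases le_total x 1 with h | h
  · rw [← hg1]
    refine le_of_deriv_nonneg_off_finite
      ((isCompact_Icc (a := x) (b := 1)).finite_inter_of_locally_finite hD) h
      (hcont.mono fun y hy => lt_of_lt_of_le hx hy.1) ?_
    rintro y ⟨hy, hyD⟩
    have hy0 : y ∈ Set.Ioi (0 : ℝ) := lt_trans hx hy.1
    have hdy := hdiff y ⟨hy0, fun h => hyD ⟨Set.Ioo_subset_Icc_self hy, h⟩⟩
    exact ⟨hdy, nonneg_of_mul_nonpos_right (hderiv y hy0 hdy) (sub_neg.2 hy.2)⟩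
  · have key : -g 1 ≤ -g x := by
      refine le_of_deriv_nonneg_off_finite (f := fun y => -g y)
        ((isCompact_Icc (a := 1) (b := x)).finite_inter_of_locally_finite hD) h
        (hcont.mono fun y hy => lt_of_lt_of_le one_pos hy.1).neg ?_
      rintro y ⟨hy, hyD⟩
      have hy0 : y ∈ Set.Ioi (0 : ℝ) := lt_trans one_pos hy.1
      have hdy := hdiff y ⟨hy0, fun h => hyD ⟨Set.Ioo_subset_Icc_self hy, h⟩⟩
      refine ⟨hdy.neg, ?_⟩
      rw [deriv.fun_neg, neg_nonneg]
      exact nonpos_of_mul_nonpos_right (hderiv y hy0 hdy) (sub_pos.2 hy.1)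
    linarith


/-- Let `g : (0, ∞) → [0, ∞)` be continuous and piecewise continuously
differentiable (continuously differentiable outside a locally finite set `D`) with `g 1 = 0`.
If `(x − 1) g′(x) ≤ 0` at every point where `g` is differentiable, then `g ≡ 0` on `(0, ∞)`.
Consequently, for every such nonzero `g` vanishing only at `1` there is a point `x` where
`g` is differentiable and `(x − 1) g′(x) > 0` (which yields the instability of the losses
`div_{g,ν}`). -/
theorem monotone_constraint_forces_zero
    (g : ℝ → ℝ) (D : Set ℝ)
    (hcont : ContinuousOn g (Set.Ioi (0 : ℝ)))
    (hg_nonneg : ∀ x ∈ Set.Ioi (0 : ℝ), 0 ≤ g x)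
    (hg1 : g 1 = 0)
    -- `D` is locally finite
    (hD : ∀ x : ℝ, ∃ U ∈ nhds x, (U ∩ D).Finite)
    -- `g` is continuously differentiable outside `D`
    (hpw : ∀ x ∈ Set.Ioi (0 : ℝ) \ D,
      DifferentiableAt ℝ g x ∧ ContinuousAt (deriv g) x)
    -- `(x − 1) g′(x) ≤ 0` wherever `g` is differentiable
    (hderiv : ∀ x ∈ Set.Ioi (0 : ℝ), DifferentiableAt ℝ g x →
      (x - 1) * deriv g x ≤ 0) :
    -- `g` is identically zero on `(0, ∞)`
    (∀ x ∈ Set.Ioi (0 : ℝ), g x = 0) ∧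
    -- consequently, a `g₂` of the same regularity vanishing exactly at `1` must have a point
    -- where `(x − 1) g₂′(x) > 0`
    (∀ (g₂ : ℝ → ℝ) (D₂ : Set ℝ),
      ContinuousOn g₂ (Set.Ioi (0 : ℝ)) →
      (∀ x ∈ Set.Ioi (0 : ℝ), 0 ≤ g₂ x) →
      (∀ x : ℝ, ∃ U ∈ nhds x, (U ∩ D₂).Finite) →
      (∀ x ∈ Set.Ioi (0 : ℝ) \ D₂,
        DifferentiableAt ℝ g₂ x ∧ ContinuousAt (deriv g₂) x) →
      (∀ x ∈ Set.Ioi (0 : ℝ), (g₂ x = 0 ↔ x = 1)) →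
      ∃ x ∈ Set.Ioi (0 : ℝ), DifferentiableAt ℝ g₂ x ∧ 0 < (x - 1) * deriv g₂ x) := by
  refine ⟨eq_zero_of_sub_one_mul_deriv_nonpos hcont hg_nonneg hg1 hD
    (fun x hx => (hpw x hx).1) hderiv, ?_⟩
  intro g₂ D₂ hcont₂ hnonneg₂ hD₂ hpw₂ hzero₂
  by_contra! hcon
  have h2 : (2 : ℝ) ∈ Set.Ioi (0 : ℝ) := Set.mem_Ioi.2 two_pos
  have := (hzero₂ 2 h2).1 (eq_zero_of_sub_one_mul_deriv_nonpos hcont₂ hnonneg₂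
    ((hzero₂ 1 (Set.mem_Ioi.2 one_pos)).2 rfl) hD₂ (fun x hx => (hpw₂ x hx).1) hcon 2 h2)
  norm_num at this
end

section
/- Stability of stable flow-matching losses (Theorem 4 for L_{FM,Δ}): let ν be a finite measure on S*, let F be an R-edgeflow and F0 a 0-flow such that the restrictions to S* of F_in, F_out, and F0,in = F0,out admit nonnegative densities ι, o, γ with respect to ν, with f(ι − o)·g(ι, o) and f(ι − o)·g(ι + γ, o + γ) ν-integrable. Suppose f : ℝ → [0, ∞) satisfies f(x) = 0 iff x = 0 and f is non-increasing on (−∞, 0] and non-decreasing on [0, ∞), and g : [0, ∞)² → [1, ∞) is continuously differentiable with ∂₁g + ∂₂g ≥ 0. Then L_{FM,Δ,f,g,ν}(F + F0) := ∫_{S*} f(ι − o)·g(ι + γ, o + γ) dν ≥ ∫_{S*} f(ι − o)·g(ι, o) dν =: L_{FM,Δ,f,g,ν}(F); i.e. adding a 0-flow does not decrease the loss, so L_{FM,Δ,f,g,ν} is stable on R-edgeflows. -/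
open MeasureTheory
open scoped ENNReal

/-- A differentiable function on the plane with nonnegative derivative along the diagonal direction
does not decrease when both coordinates are shifted by the same nonnegative amount. -/
theorem le_diagonal_shift {g : ℝ × ℝ → ℝ} (hg : Differentiable ℝ g)
    (hderiv : ∀ p : ℝ × ℝ, 0 ≤ fderiv ℝ g p (1, 1)) (a b : ℝ) {c : ℝ} (hc : 0 ≤ c) :
    g (a, b) ≤ g (a + c, b + c) := by
  have hd : ∀ t : ℝ, HasDerivAt (fun t : ℝ => g (a + t, b + t))
      (fderiv ℝ g (a + t, b + t) (1, 1)) t := fun t =>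
    (hg (a + t, b + t)).hasFDerivAt.comp_hasDerivAt t
      (((hasDerivAt_id t).const_add a).prodMk ((hasDerivAt_id t).const_add b))
  have hmono : Monotone (fun t : ℝ => g (a + t, b + t)) :=
    monotone_of_hasDerivAt_nonneg hd fun t => hderiv _
  simpa using hmono hc

/-- **stability of the stable flow-matching losses.** Let `ν` be a finite
training measure, `F` an `R`-edgeflow and `F0` a `0`-flow such that, on `S* = {s0, sf}ᶜ`,
`F_in`, `F_out` and `F0_in = F0_out` have nonnegative densities `ι`, `o`, `γ` with respect
to `ν`. If `f : ℝ → [0, ∞)` vanishes exactly at `0`, is non-increasing on `(−∞, 0]` and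
non-decreasing on `[0, ∞)`, and `g : ℝ² → [1, ∞)` is continuously differentiable with
`∂₁ g + ∂₂ g ≥ 0`, then
`L_{FM,Δ,f,g,ν}(F + F0) = ∫_{S*} f(ι − o) g(ι + γ, o + γ) dν`
`  ≥ ∫_{S*} f(ι − o) g(ι, o) dν = L_{FM,Δ,f,g,ν}(F)`:
adding a `0`-flow does not decrease the loss. -/
theorem stable_FM_loss_is_stable
    {S : Type*} [MeasurableSpace S] [MeasurableSingletonClass S]
    (s0 sf : S) (hne : s0 ≠ sf)
    (ν : Measure S) [IsFiniteMeasure ν]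
    -- the reward `R`
    (R : Measure S) [IsFiniteMeasure R] (hRs0 : R {s0} = 0) (hRsf : R {sf} = 0)
    -- `F` is an `R`-edgeflow
    (F : Measure (S × S)) [IsFiniteMeasure F]
    (hFsrc : F (Set.univ ×ˢ {s0}) = 0)
    (hFsnk : F ({sf} ×ˢ ({sf}ᶜ : Set S)) = 0)
    (hreward : ∀ A : Set S, MeasurableSet A → F (A ×ˢ {sf}) = R A)
    -- `F0` is a `0`-flow
    (F0 : Measure (S × S)) [IsFiniteMeasure F0]
    (hF0src : F0 (Set.univ ×ˢ {s0}) = 0)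
    (hF0snk : F0 ({sf} ×ˢ ({sf}ᶜ : Set S)) = 0)
    (hF0sink : F0 (Set.univ ×ˢ {sf}) = 0)
    (hF0match : ∀ A : Set S, MeasurableSet A → A ⊆ ({s0, sf} : Set S)ᶜ →
      F0.map Prod.snd A = F0.map Prod.fst A)
    -- `ι`, `o`, `γ` are the densities on `S*` of `F_in`, `F_out`, `F0_in = F0_out` w.r.t. `ν`
    (ι o γ : S → ℝ)
    (hιm : Measurable ι) (hom : Measurable o) (hγm : Measurable γ)
    (hι0 : ∀ x, 0 ≤ ι x) (ho0 : ∀ x, 0 ≤ o x) (hγ0 : ∀ x, 0 ≤ γ x)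
    (hdι : ∀ A : Set S, MeasurableSet A → A ⊆ ({s0, sf} : Set S)ᶜ →
      F.map Prod.snd A = ∫⁻ x in A, ENNReal.ofReal (ι x) ∂ν)
    (hdo : ∀ A : Set S, MeasurableSet A → A ⊆ ({s0, sf} : Set S)ᶜ →
      F.map Prod.fst A = ∫⁻ x in A, ENNReal.ofReal (o x) ∂ν)
    (hdγ : ∀ A : Set S, MeasurableSet A → A ⊆ ({s0, sf} : Set S)ᶜ →
      F0.map Prod.fst A = ∫⁻ x in A, ENNReal.ofReal (γ x) ∂ν)
    -- hypotheses on `f`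
    (f : ℝ → ℝ) (hf_nonneg : ∀ x : ℝ, 0 ≤ f x) (hf_zero : ∀ x : ℝ, f x = 0 ↔ x = 0)
    (hf_anti : AntitoneOn f (Set.Iic 0)) (hf_mono : MonotoneOn f (Set.Ici 0))
    -- hypotheses on `g`
    (g : ℝ × ℝ → ℝ) (hg : ContDiff ℝ 1 g) (hg_one : ∀ p : ℝ × ℝ, 1 ≤ g p)
    (hg_deriv : ∀ p : ℝ × ℝ, 0 ≤ fderiv ℝ g p (1, 1))
    -- integrability of both losses
    (hint1 : IntegrableOn (fun x => f (ι x - o x) * g (ι x, o x))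
      (({s0, sf} : Set S)ᶜ) ν)
    (hint2 : IntegrableOn (fun x => f (ι x - o x) * g (ι x + γ x, o x + γ x))
      (({s0, sf} : Set S)ᶜ) ν) :
    -- `L_{FM,Δ,f,g,ν}(F) ≤ L_{FM,Δ,f,g,ν}(F + F0)`
    ∫ x in (({s0, sf} : Set S)ᶜ), f (ι x - o x) * g (ι x, o x) ∂ν ≤
      ∫ x in (({s0, sf} : Set S)ᶜ), f (ι x - o x) * g (ι x + γ x, o x + γ x) ∂ν := by
  exact integral_mono hint1 hint2 fun x =>
    mul_le_mul_of_nonneg_left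
      (le_diagonal_shift (hg.differentiable one_ne_zero) hg_deriv _ _ (hγ0 x)) (hf_nonneg _)
end

section
/- Let α > 0 and let ℒ, ℛ be real-valued functionals on finite nonnegative measures on S × S. Suppose F is an R-edgeflow minimizing ℒ + α·ℛ over the set of all R-edgeflows, and suppose that for every nontrivial 0-subflow F0 of F the functions t ↦ ℒ(F + t·F0) and t ↦ ℛ(F + t·F0) are differentiable at t = 0 with (d/dt)ℒ(F + tF0)|_{t=0} ≥ 0 and (d/dt)ℛ(F + tF0)|_{t=0} > 0. Then F admits no nontrivial 0-subflow, i.e. F is a minimal edgeflow. (Note that F + t·F0 is again an R-edgeflow for all t ∈ (−1, ∞) since F0 ≤ F and F0(S × {sf}) = 0.) -/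
open MeasureTheory
open scoped ENNReal

variable {S : Type*} [MeasurableSpace S]

/-- An `R`-edgeflow: an edgeflow satisfying the reward constraint `F(A × {sf}) = R(A)`. -/
def IsREdgeflow (s0 sf : S) (R : Measure S) (F : Measure (S × S)) : Prop :=
  IsEdgeflow s0 sf F ∧ ∀ A : Set S, MeasurableSet A → F (A ×ˢ {sf}) = R A

/-- A `0`-subflow of `F`: a `0`-flow (edgeflow with flow matching on `S*` and no mass into
the sink) bounded above by `F`. -/
def IsZeroSubflow (s0 sf : S) (F F0 : Measure (S × S)) : Prop :=
  IsEdgeflow s0 sf F0 ∧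
  (∀ A : Set S, MeasurableSet A → A ⊆ ({s0, sf} : Set S)ᶜ →
    F0.map Prod.snd A = F0.map Prod.fst A) ∧
  F0 (Set.univ ×ˢ {sf}) = 0 ∧ F0 ≤ F

/-- The perturbation `F + t F0` of an edgeflow `F` in the direction of a `0`-subflow
`F0 ≤ F`, defined for every real `t` (for `t < 0` via truncated subtraction of measures,
which agrees with the signed difference as long as `t ≥ -1` since `F0 ≤ F`). -/
noncomputable def linePerturb (F F0 : Measure (S × S)) (t : ℝ) : Measure (S × S) :=
  if 0 ≤ t then F + ENNReal.ofReal t • F0 else F - ENNReal.ofReal (-t) • F0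

lemma linePerturb_zero (F F0 : Measure (S × S)) : linePerturb F F0 0 = F := by
  simp [linePerturb]

/-- Moving along a `0`-subflow with parameter `t > -1` preserves `R`-edgeflows. -/
lemma IsREdgeflow.linePerturb [MeasurableSingletonClass S] {s0 sf : S} {R : Measure S}
    {F F0 : Measure (S × S)} (hF : IsREdgeflow s0 sf R F) (hF0 : IsZeroSubflow s0 sf F F0)
    {t : ℝ} (ht : -1 < t) : IsREdgeflow s0 sf R (linePerturb F F0 t) := by
  obtain ⟨⟨hfin, hin, hout⟩, hR⟩ := hF
  obtain ⟨⟨hfin0, hin0, hout0⟩, -, hsink, hle⟩ := hF0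
  have hsink' (A : Set S) : F0 (A ×ˢ {sf}) = 0 :=
    measure_mono_null (Set.prod_mono_left (Set.subset_univ A)) hsink
  unfold _root_.linePerturb
  split_ifs with h
  · have : IsFiniteMeasure (ENNReal.ofReal t • F0) := F0.smul_finite ENNReal.ofReal_ne_top
    refine ⟨⟨inferInstance, ?_, ?_⟩, fun A hA => ?_⟩
    · simp [hin, hin0]
    · simp [hout, hout0]
    · simp [hR A hA, hsink']
  · have hfin1 : IsFiniteMeasure (ENNReal.ofReal (-t) • F0) :=
      F0.smul_finite ENNReal.ofReal_ne_top
    have hle' : ENNReal.ofReal (-t) • F0 ≤ F := by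
      refine Measure.le_intro fun B _ _ => ?_
      calc ENNReal.ofReal (-t) * F0 B ≤ 1 * F0 B := by
            gcongr
            exact ENNReal.ofReal_le_one.2 (by linarith)
        _ ≤ F B := by simpa using hle B
    have hsub : F - ENNReal.ofReal (-t) • F0 ≤ F := Measure.sub_le
    refine ⟨⟨inferInstance, ?_, ?_⟩, fun A hA => ?_⟩
    · exact nonpos_iff_eq_zero.1 ((hsub _).trans_eq hin)
    · exact nonpos_iff_eq_zero.1 ((hsub _).trans_eq hout)
    · rw [Measure.sub_apply (hA.prod (measurableSet_singleton sf)) hle']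
      simp [hR A hA, hsink']

/-- Let `α > 0` and `ℒ, ℛ` be real functionals on measures on `S × S`.
If an `R`-edgeflow `F` minimizes `ℒ + α ℛ` over all `R`-edgeflows and, for every nontrivial
`0`-subflow `F0` of `F`, the maps `t ↦ ℒ(F + t F0)` and `t ↦ ℛ(F + t F0)` are differentiable
at `t = 0` with derivatives `≥ 0` and `> 0` respectively, then `F` admits no nontrivial
`0`-subflow, i.e. `F` is a minimal edgeflow. -/
theorem minimizer_of_regularized_loss_is_minimal [MeasurableSingletonClass S]
    (s0 sf : S) (hne : s0 ≠ sf)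
    (R : Measure S) [IsFiniteMeasure R] (hRs0 : R {s0} = 0) (hRsf : R {sf} = 0)
    (L Reg : Measure (S × S) → ℝ) (α : ℝ) (hα : 0 < α)
    (F : Measure (S × S)) (hF : IsREdgeflow s0 sf R F)
    -- `F` minimizes `ℒ + α ℛ` over `R`-edgeflows
    (hmin : ∀ G : Measure (S × S), IsREdgeflow s0 sf R G →
      L F + α * Reg F ≤ L G + α * Reg G)
    -- directional differentiability along nontrivial `0`-subflows, with the sign conditions
    (hderiv : ∀ F0 : Measure (S × S), IsZeroSubflow s0 sf F F0 → F0 ≠ 0 →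
      ∃ dL dR : ℝ,
        HasDerivAt (fun t : ℝ => L (linePerturb F F0 t)) dL 0 ∧ 0 ≤ dL ∧
        HasDerivAt (fun t : ℝ => Reg (linePerturb F F0 t)) dR 0 ∧ 0 < dR) :
    -- `F` is minimal: it admits no nontrivial `0`-subflow
    ∀ F0 : Measure (S × S), IsZeroSubflow s0 sf F F0 → F0 = 0 := by
  intro F0 hF0
  by_contra hne0
  obtain ⟨dL, dR, hL, hdL, hReg, hdR⟩ := hderiv F0 hF0 hne0
  have hloc : IsLocalMin
      (fun t : ℝ => L (linePerturb F F0 t) + α * Reg (linePerturb F F0 t)) 0 := by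
    filter_upwards [Ioi_mem_nhds (show (-1 : ℝ) < 0 by norm_num)] with t ht
    simpa only [linePerturb_zero] using hmin _ (hF.linePerturb hF0 ht)
  have hzero : dL + α * dR = 0 := hloc.hasDerivAt_eq_zero (hL.add (hReg.const_mul α))
  have := mul_pos hα hdR
  linarith
end

section
/- Let S be a standard Borel space and let F1, F2 be finite nonnegative measures on S × S with F1 ≪ F2 (absolutely continuous). Then the first marginals satisfy F1_out ≪ F2_out, where F_out(A) := F(A × S), and for F1_out-almost every x ∈ S the disintegration kernels satisfy π^{F1}(x, ·) ≪ π^{F2}(x, ·); here π^{F} denotes the forward policy of F, i.e. the Markov kernel obtained from the disintegration F(A × B) = ∫_A π^{F}(x, B) dF_out(x) of F over its first marginal. -/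
open MeasureTheory ProbabilityTheory

/-- Let `S` be a standard Borel space and `F1, F2` finite nonnegative
measures on `S × S` with `F1 ≪ F2`. Then the first marginals satisfy `F1_out ≪ F2_out`,
and for `F1_out`-almost every `x` the disintegration kernels (forward policies, i.e. the
conditional kernels with `F = F_out ⊗ π^F`) satisfy `π^{F1}(x, ·) ≪ π^{F2}(x, ·)`. -/
theorem forward_policy_absolutely_continuous
    {S : Type*} [MeasurableSpace S] [StandardBorelSpace S] [Nonempty S]
    (F1 F2 : Measure (S × S)) [IsFiniteMeasure F1] [IsFiniteMeasure F2]
    (h : F1 ≪ F2) :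
    F1.fst ≪ F2.fst ∧
    ∀ᵐ x ∂F1.fst, F1.condKernel x ≪ F2.condKernel x := by
  refine Measure.absolutelyContinuous_compProd_iff'.1 ?_
  rwa [F1.disintegrate F1.condKernel, F2.disintegrate F2.condKernel]
end
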